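/- Let (W,S) be a finite irreducible Coxeter system of rank n with Coxeter number h, and for 0 ≤ k ≤ n let TW_k(W) denote the number of chains 1 = x₀ < x₁ < ⋯ < x_k in the noncrossing partition lattice L_W with ℓ_T(x_i) = i for all i (equivalently, the number of reduced T-words t₁t₂⋯t_k of elements of absolute length k in L_W). Then for every k ≥ 1, 2·TW_k(W) = h · ∑_{s∈S} TW_{k−1}(W_⟨s⟩). -/

import Mathlib

open scoped BigOperators

section Defs

variable {G : Type*} [Group G]

/-- `t` is a reflection with respect to the generating set `S`:
a conjugate of an element of `S`. -/
def IsReflectionOf (S : Set G) (t : G) : Prop :=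
  ∃ g : G, ∃ s ∈ S, t = g * s * g⁻¹

/-- The absolute length of `w`: the minimal length of a word in the
reflections (conjugates of elements of `S`) whose product is `w`. -/
noncomputable def absLength (S : Set G) (w : G) : ℕ :=
  sInf {k | ∃ l : List G, (∀ t ∈ l, IsReflectionOf S t) ∧ l.length = k ∧ l.prod = w}

/-- The absolute order: `u ≤ v` iff `ℓ_T(u) + ℓ_T(u⁻¹v) = ℓ_T(v)`. -/
def absLe (S : Set G) (u v : G) : Prop :=
  absLength S u + absLength S (u⁻¹ * v) = absLength S v

/-- `c` is a Coxeter element with respect to the set `S` of simple reflections: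
a product of all the elements of `S`, each occurring exactly once, in some order. -/
def IsCoxeterElementOf (S : Set G) (c : G) : Prop :=
  ∃ l : List G, l.Nodup ∧ (∀ x, x ∈ l ↔ x ∈ S) ∧ l.prod = c

/-- The rank-selected multichain count `C_{(j₁,…,j_m)}(W)`: the number of multichains
`x₁ ≤ ⋯ ≤ x_{m-1}` in the interval `[1,c]` of the absolute order whose sequence of
rank jumps (prepending `1` and appending `c`) is given by `j`. -/
noncomputable def chainCount (S : Set G) (c : G) {m : ℕ} (j : Fin m → ℕ) : ℕ :=
  Nat.card {y : Fin (m + 1) → G //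
    y 0 = 1 ∧ y (Fin.last m) = c ∧
    (∀ i, absLe S (y i) c) ∧
    (∀ i : Fin m, absLe S (y i.castSucc) (y i.succ)) ∧
    (∀ i : Fin m, absLength S (y i.succ) = absLength S (y i.castSucc) + j i)}

end Defs

section Cox

variable {B : Type*} {W : Type*} [Group W] {M : CoxeterMatrix B}

/-- The set of simple reflections of a Coxeter system. -/
def simpleSet (cs : CoxeterSystem M W) : Set W := Set.range cs.simple

/-- A Coxeter system is irreducible if its set of simple reflections is nonempty and cannot
be partitioned into two nonempty subsets such that every simple reflection in one commutes
with every simple reflection in the other. -/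
def IsIrreducibleCS (cs : CoxeterSystem M W) : Prop :=
  Nonempty B ∧
    ∀ A : Set B, (∀ a ∈ A, ∀ b ∈ Aᶜ, Commute (cs.simple a) (cs.simple b)) →
      A = ∅ ∨ A = Set.univ

/-- The standard parabolic subgroup `W_⟨s⟩` generated by the simple reflections
other than `cs.simple s`. -/
def parabolic (cs : CoxeterSystem M W) (s : B) : Subgroup W :=
  Subgroup.closure (Set.range cs.simple \ {cs.simple s})

/-- The set of simple reflections of the parabolic subgroup `W_⟨s⟩`, viewed as
elements of that subgroup. -/
def parabolicGens (cs : CoxeterSystem M W) (s : B) : Set (parabolic cs s) :=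
  {x | (x : W) ∈ Set.range cs.simple \ {cs.simple s}}

end Cox

section MoreCounts

variable {G : Type*} [Group G]

/-- `TW_k(W)`: the number of chains `1 = x₀ < x₁ < ⋯ < x_k` in the noncrossing partition
lattice `[1,c]` with `ℓ_T(xᵢ) = i` for all `i` (equivalently, the number of reduced
`T`-words of elements of absolute length `k` in `[1,c]`). -/
noncomputable def twCount (S : Set G) (c : G) (k : ℕ) : ℕ :=
  Nat.card {y : Fin (k + 1) → G //
    y 0 = 1 ∧ (∀ i, absLe S (y i) c) ∧
    (∀ i : Fin k, absLe S (y i.castSucc) (y i.succ)) ∧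
    (∀ i : Fin (k + 1), absLength S (y i) = (i : ℕ))}

/-- `NC(W)`: the number of elements of the noncrossing partition lattice `[1,c]`. -/
noncomputable def ncCount (S : Set G) (c : G) : ℕ :=
  Nat.card {w : G // absLe S w c}

/-- `E(W)`: the number of edges of the Hasse diagram of the noncrossing partition lattice
`[1,c]`, i.e. pairs `(x,y)` with `x ≤ y` in `[1,c]` and `ℓ_T(y) = ℓ_T(x) + 1`. -/
noncomputable def edgeCount (S : Set G) (c : G) : ℕ :=
  Nat.card {p : G × G // absLe S p.1 c ∧ absLe S p.2 c ∧ absLe S p.1 p.2 ∧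
    absLength S p.2 = absLength S p.1 + 1}

/-- `SC_k(W)`: the number of saturated chains `x₀ < x₁ < ⋯ < x_k` of length `k` in the
noncrossing partition lattice `[1,c]`, i.e. with `ℓ_T(xᵢ) = ℓ_T(x₀) + i` for all `i`. -/
noncomputable def scCount (S : Set G) (c : G) (k : ℕ) : ℕ :=
  Nat.card {y : Fin (k + 1) → G //
    (∀ i, absLe S (y i) c) ∧
    (∀ i : Fin k, absLe S (y i.castSucc) (y i.succ)) ∧
    (∀ i : Fin k, absLength S (y i.succ) = absLength S (y i.castSucc) + 1)}

end MoreCounts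

namespace GeomRep

section Form

variable {B : Type*} [Fintype B] [DecidableEq B] (M : CoxeterMatrix B)

/-- The canonical symmetric bilinear form of a Coxeter matrix. -/
noncomputable def form : LinearMap.BilinForm ℝ (B → ℝ) :=
  Matrix.toBilin' (Matrix.of fun i j => -Real.cos (Real.pi / M i j))

/-- The simple root indexed by `i`. -/
def root (i : B) : B → ℝ := Pi.single i 1

lemma form_root_root (i j : B) :
    form M (root i) (root j) = -Real.cos (Real.pi / M i j) := by
  simp [form, root]

lemma form_comm (x y : B → ℝ) : form M x y = form M y x := by
  simp only [form, Matrix.toBilin'_apply]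
  rw [Finset.sum_comm]
  refine Finset.sum_congr rfl fun i _ => Finset.sum_congr rfl fun j _ => ?_
  simp only [Matrix.of_apply, M.symmetric j i]
  ring

lemma form_root_self (i : B) : form M (root i) (root i) = 1 := by
  simp [form_root_root]

lemma eq_sum_root (x : B → ℝ) : x = ∑ i, x i • root i := by
  ext j
  simp [root, Pi.single_apply]

/-- The linear reflection in the simple root indexed by `i`. -/
noncomputable def refl (i : B) : Module.End ℝ (B → ℝ) :=
  LinearMap.id - (2 : ℝ) • (form M (root i)).smulRight (root i)

lemma refl_apply (i : B) (x : B → ℝ) :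
    refl M i x = x - (2 * form M (root i) x) • root i := by
  simp [refl, smul_smul]

lemma refl_root_self (i : B) : refl M i (root i) = -root i := by
  rw [refl_apply, form_root_self]
  module

lemma refl_mul_self (i : B) : refl M i * refl M i = 1 := by
  refine LinearMap.ext fun x => ?_
  rw [Module.End.mul_apply, refl_apply M i x, map_sub, map_smul, refl_root_self, refl_apply,
    Module.End.one_apply]
  module

lemma form_refl_refl (i : B) (x y : B → ℝ) :
    form M (refl M i x) (refl M i y) = form M x y := by
  simp only [refl_apply, map_sub, map_smul, LinearMap.sub_apply, LinearMap.smul_apply,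
    form_root_self, form_comm M x (root i), smul_eq_mul]
  ring

lemma exists_coeff {m : ℕ} (hm : m ≠ 1) : ∃ a : ℕ → ℝ, a 0 = 0 ∧ a 1 = 1 ∧
    (∀ p, a (p + 2) = 2 * Real.cos (Real.pi / m) * a (p + 1) - a p) ∧
    (∀ p, (m ≠ 0 → p ≤ m) → 0 ≤ a p) ∧ (m ≠ 0 → a (2 * m) = 0 ∧ a (2 * m + 1) = 1) := by
  rcases Nat.eq_zero_or_pos m with rfl | hpos
  · refine ⟨fun p => p, by simp, by simp, fun p => ?_, fun p _ => by positivity, by simp⟩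
    push_cast
    simp
    ring
  have hm2 : (2 : ℝ) ≤ m := by exact_mod_cast (by omega : 2 ≤ m)
  have hm0 : (m : ℝ) ≠ 0 := by positivity
  have hsin : 0 < Real.sin (Real.pi / m) := by
    apply Real.sin_pos_of_pos_of_lt_pi
    · positivity
    · rw [div_lt_iff₀ (by positivity)]
      nlinarith [Real.pi_pos]
  refine ⟨fun p => Real.sin (p * (Real.pi / m)) / Real.sin (Real.pi / m), by simp, ?_,
    fun p => ?_, fun p hp => ?_, fun _ => ⟨?_, ?_⟩⟩
  · simp [hsin.ne']
  · have h2 : Real.sin (((p + 2 : ℕ) : ℝ) * (Real.pi / m)) =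
        2 * Real.cos (Real.pi / m) * Real.sin (((p + 1 : ℕ) : ℝ) * (Real.pi / m))
          - Real.sin (p * (Real.pi / m)) := by
      have e1 : ((p + 2 : ℕ) : ℝ) * (Real.pi / m)
          = ((p + 1 : ℕ) : ℝ) * (Real.pi / m) + Real.pi / m := by push_cast; ring
      have e2 : (p : ℝ) * (Real.pi / m)
          = ((p + 1 : ℕ) : ℝ) * (Real.pi / m) - Real.pi / m := by push_cast; ring
      rw [e1, e2, Real.sin_add, Real.sin_sub]
      ring
    simp only [h2]
    ring
  · apply div_nonneg _ hsin.le
    apply Real.sin_nonneg_of_nonneg_of_le_pi (by positivity)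
    have : (p : ℝ) ≤ m := by exact_mod_cast hp hpos.ne'
    rw [mul_div_assoc', div_le_iff₀ (by positivity)]
    nlinarith [Real.pi_pos]
  · have : ((2 * m : ℕ) : ℝ) * (Real.pi / m) = 2 * Real.pi := by
      push_cast; field_simp
    simp only [this, Real.sin_two_pi, zero_div]
  · have : ((2 * m + 1 : ℕ) : ℝ) * (Real.pi / m) = Real.pi / m + 2 * Real.pi := by
      push_cast; field_simp; ring
    simp only [this, Real.sin_add_two_pi]
    exact div_self hsin.ne'

lemma mul_pow_root {i j : B} {a : ℕ → ℝ} (h0 : a 0 = 0) (h1 : a 1 = 1)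
    (ha : ∀ p, a (p + 2) = 2 * Real.cos (Real.pi / M i j) * a (p + 1) - a p) (m : ℕ) :
    ((refl M i * refl M j) ^ m) (root i) = a (2 * m + 1) • root i + a (2 * m) • root j ∧
    ((refl M i * refl M j) ^ m) (root j) = -a (2 * m) • root i -
      (2 * Real.cos (Real.pi / M i j) * a (2 * m) - a (2 * m + 1)) • root j := by
  induction m with
  | zero => simp [h0, h1]
  | succ m ih =>
    have e2 : a (2 * (m + 1)) = _ := ha (2 * m)
    have e3 : a (2 * (m + 1) + 1) = _ := ha (2 * m + 1)
    have e2' := ha (2 * m)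
    rw [pow_succ', Module.End.mul_apply, Module.End.mul_apply _ _ (root j), ih.1, ih.2, e3, e2,
      e2']
    simp only [Module.End.mul_apply, refl_apply, map_sub, map_add, map_smul,
      form_root_self, form_root_root, M.symmetric j i]
    constructor <;> module

lemma isLiftable_refl : M.IsLiftable (refl M) := by
  intro i j
  by_cases hij : i = j
  · subst hij
    simp [refl_mul_self]
  have hm : M i j ≠ 1 := M.off_diagonal i j hij
  rcases Nat.eq_zero_or_pos (M i j) with h0 | hpos
  · simp [h0]
  obtain ⟨a, h0, h1, ha, -, hp⟩ := exists_coeff hm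
  have hri := mul_pow_root M h0 h1 ha (M i j)
  rw [(hp hpos.ne').1, (hp hpos.ne').2] at hri
  set c := Real.cos (Real.pi / M i j) with hc
  have hc2 : 1 - c ^ 2 ≠ 0 := by
    have hm2 : (2 : ℝ) ≤ M i j := by exact_mod_cast (by omega : 2 ≤ M i j)
    have hsin : 0 < Real.sin (Real.pi / M i j) := by
      apply Real.sin_pos_of_pos_of_lt_pi
      · positivity
      · rw [div_lt_iff₀ (by positivity)]
        nlinarith [Real.pi_pos]
    have := Real.sin_sq_add_cos_sq (Real.pi / M i j)
    rw [← hc] at this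
    nlinarith
  refine LinearMap.ext fun x => ?_
  rw [Module.End.one_apply]
  set u := form M (root i) x with hu
  set v := form M (root j) x with hv
  set p := (u + c * v) / (1 - c ^ 2) with hpd
  set q := (v + c * u) / (1 - c ^ 2) with hq
  set y := x - p • root i - q • root j with hy
  have hyi : form M (root i) y = 0 := by
    simp only [hy, map_sub, map_smul, form_root_self, form_root_root, ← hu, ← hc, smul_eq_mul]
    rw [hpd, hq]
    field_simp
    ring
  have hyj : form M (root j) y = 0 := by
    simp only [hy, map_sub, map_smul, form_root_self, form_root_root, M.symmetric j i, ← hv,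
      ← hc, smul_eq_mul]
    rw [hpd, hq]
    field_simp
    ring
  have hfix : ∀ m, ((refl M i * refl M j) ^ m) y = y := by
    intro m
    induction m with
    | zero => simp
    | succ m ih =>
      rw [pow_succ', Module.End.mul_apply, ih, Module.End.mul_apply, refl_apply M j, hyj]
      simp [refl_apply, hyi]
  have hx : x = y + p • root i + q • root j := by rw [hy]; module
  rw [hx]
  simp only [map_add, map_smul, hri.1, hri.2, hfix]
  module

lemma alternatingWord_root {i j : B} {a : ℕ → ℝ} (h0 : a 0 = 0) (h1 : a 1 = 1)
    (ha : ∀ p, a (p + 2) = 2 * Real.cos (Real.pi / M i j) * a (p + 1) - a p) (p : ℕ) :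
    ((CoxeterSystem.alternatingWord i j p).map (refl M)).prod (root i) =
      if Even p then a (p + 1) • root i + a p • root j
      else a p • root i + a (p + 1) • root j := by
  induction p with
  | zero => simp [CoxeterSystem.alternatingWord, h0, h1]
  | succ p ih =>
    rw [CoxeterSystem.alternatingWord_succ', List.map_cons, List.prod_cons, Module.End.mul_apply,
      ih, ha p]
    by_cases hp : Even p
    · have hp' : ¬ Even (p + 1) := by simpa [Nat.even_add_one] using hp
      simp only [hp, hp', if_true, if_false, refl_apply, map_add, map_smul, form_root_self,
        form_root_root, M.symmetric j i]
      module
    · have hp' : Even (p + 1) := by simpa [Nat.even_add_one] using hp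
      simp only [hp, hp', if_true, if_false, refl_apply, map_add, map_smul, form_root_self,
        form_root_root]
      module

end Form

section Rep

variable {B : Type*} [Fintype B] [DecidableEq B] {M : CoxeterMatrix B} {W : Type*} [Group W]
  (cs : CoxeterSystem M W)

/-- The geometric representation of a Coxeter system. -/
noncomputable def rep : W →* Module.End ℝ (B → ℝ) := cs.lift ⟨refl M, isLiftable_refl M⟩

lemma rep_simple (i : B) : rep cs (cs.simple i) = refl M i :=
  cs.lift_apply_simple (isLiftable_refl M) i

lemma rep_wordProd (l : List B) : rep cs (cs.wordProd l) = (l.map (refl M)).prod := by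
  induction l with
  | nil => simp
  | cons i l ih => rw [cs.wordProd_cons, map_mul, ih, rep_simple, List.map_cons, List.prod_cons]

lemma rep_mul_apply (u v : W) (x : B → ℝ) : rep cs (u * v) x = rep cs u (rep cs v x) := by
  rw [map_mul, Module.End.mul_apply]

lemma rep_inv_rep (w : W) (x : B → ℝ) : rep cs w⁻¹ (rep cs w x) = x := by
  rw [← rep_mul_apply, inv_mul_cancel, map_one, Module.End.one_apply]

lemma rep_rep_inv (w : W) (x : B → ℝ) : rep cs w (rep cs w⁻¹ x) = x := by
  rw [← rep_mul_apply, mul_inv_cancel, map_one, Module.End.one_apply]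

lemma form_rep_rep (w : W) (x y : B → ℝ) :
    form M (rep cs w x) (rep cs w y) = form M x y := by
  induction w using cs.simple_induction_left generalizing x y with
  | one => simp
  | mul_simple_left w i ih =>
    rw [rep_mul_apply, rep_mul_apply, rep_simple, form_refl_refl, ih]

lemma form_rep_left (w : W) (x y : B → ℝ) :
    form M (rep cs w x) y = form M x (rep cs w⁻¹ y) := by
  rw [← form_rep_rep cs w x, rep_rep_inv]

/-- If `w sᵢ` is longer than `w`, then `w` maps the simple root `αᵢ` to a positive root. -/
theorem rep_root_nonneg_of_length_lt (w : W) (i : B)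
    (hi : cs.length w < cs.length (w * cs.simple i)) : 0 ≤ rep cs w (root i) := by
  induction hn : cs.length w using Nat.strong_induction_on generalizing w i with
  | _ n ih =>
  subst hn
  by_cases hw : w = 1
  · subst hw
    simp only [map_one, Module.End.one_apply, root]
    exact Pi.single_nonneg.2 zero_le_one
  obtain ⟨j, hj⟩ := cs.exists_rightDescent_of_ne_one hw
  have hj' := cs.isRightDescent_iff.1 hj
  have hij : i ≠ j := by
    rintro rfl
    exact absurd hi (not_lt.2 hj.le)
  -- `Q p` says that `w = v * u` with `u` alternating of length `p` and lengths adding up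
  let Q : ℕ → Prop := fun p =>
    cs.length (w * (cs.wordProd (CoxeterSystem.alternatingWord i j p))⁻¹) + p = cs.length w
  have hQ1 : Q 1 := by
    simpa [Q, CoxeterSystem.alternatingWord] using hj'
  have hQle : ∀ p, Q p → p ≤ cs.length w := fun p hp => by
    simp only [Q] at hp
    omega
  classical
  obtain ⟨p, hp1, hQp, hmax⟩ : ∃ p, 1 ≤ p ∧ Q p ∧ ¬ Q (p + 1) := by
    by_contra hcon
    push Not at hcon
    have : ∀ p, 1 ≤ p → Q p := fun p hp => Nat.le_induction hQ1 (fun p hp h => hcon p hp h) p hp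
    have := hQle _ (this (cs.length w + 1) (by omega))
    omega
  set u := cs.wordProd (CoxeterSystem.alternatingWord i j p) with hu
  set v := w * u⁻¹ with hv
  have hwvu : w = v * u := by rw [hv]; group
  have hlen : cs.length v + p = cs.length w := hQp
  -- neither `i` nor `j` is a right descent of `v`
  have hdesc : cs.length v < cs.length (v * cs.simple i) ∧
      cs.length v < cs.length (v * cs.simple j) := by
    have key : ∀ a b : B, u = cs.simple b *
          cs.wordProd (CoxeterSystem.alternatingWord i j (p - 1)) →
        cs.wordProd (CoxeterSystem.alternatingWord i j (p + 1)) = cs.simple a * u →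
        cs.length v < cs.length (v * cs.simple a) ∧
          cs.length v < cs.length (v * cs.simple b) := by
      intro a b hb ha
      constructor
      · rcases cs.length_mul_simple v a with h | h
        · omega
        · exfalso
          apply hmax
          simp only [Q]
          have e : w * (cs.wordProd (CoxeterSystem.alternatingWord i j (p + 1)))⁻¹
              = v * cs.simple a := by
            rw [ha, mul_inv_rev, cs.inv_simple, ← mul_assoc]
          rw [e]
          omega
      · rcases cs.length_mul_simple v b with h | h
        · omega
        · exfalso
          have e : w = v * cs.simple b *
              cs.wordProd (CoxeterSystem.alternatingWord i j (p - 1)) := by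
            rw [mul_assoc, ← hb, ← hwvu]
          have h1 := cs.length_mul_le (v * cs.simple b)
            (cs.wordProd (CoxeterSystem.alternatingWord i j (p - 1)))
          have h2 := cs.length_wordProd_le (CoxeterSystem.alternatingWord i j (p - 1))
          rw [CoxeterSystem.length_alternatingWord] at h2
          rw [← e] at h1
          omega
    have hp : p = (p - 1) + 1 := by omega
    have e1 : u = cs.simple (if Even (p - 1) then j else i) *
        cs.wordProd (CoxeterSystem.alternatingWord i j (p - 1)) := by
      rw [hu, hp, CoxeterSystem.alternatingWord_succ', cs.wordProd_cons, Nat.add_sub_cancel]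
    have e2 : cs.wordProd (CoxeterSystem.alternatingWord i j (p + 1)) =
        cs.simple (if Even p then j else i) * u := by
      rw [CoxeterSystem.alternatingWord_succ', cs.wordProd_cons]
    have hk := key _ _ e1 e2
    have hpar : Even p ↔ ¬ Even (p - 1) := by
      conv_lhs => rw [hp]
      exact Nat.even_add_one
    by_cases hev : Even p
    · have h' := hpar.1 hev
      simp only [hev, h', if_true, if_false] at hk
      exact hk.symm
    · have h' : Even (p - 1) := by
        by_contra h'
        exact hev (hpar.2 h')
      simp only [hev, h', if_true, if_false] at hk
      exact hk
  have hvi := ih (cs.length v) (by omega) v i hdesc.1 rfl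
  have hvj := ih (cs.length v) (by omega) v j hdesc.2 rfl
  -- the length of `u` is bounded by the order of the dihedral group
  have hred : cs.IsReduced (CoxeterSystem.alternatingWord j i (p + 1)) := by
    have h1 := cs.length_mul_le v (u * cs.simple i)
    rw [← mul_assoc, ← hwvu] at h1
    have h2 : cs.wordProd (CoxeterSystem.alternatingWord j i (p + 1)) = u * cs.simple i := by
      rw [CoxeterSystem.alternatingWord_succ, cs.wordProd_concat]
    have h3 := cs.length_wordProd_le (CoxeterSystem.alternatingWord j i (p + 1))
    rw [CoxeterSystem.IsReduced, h2]
    rw [h2, CoxeterSystem.length_alternatingWord] at h3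
    rw [CoxeterSystem.length_alternatingWord]
    omega
  have hbound : M i j ≠ 0 → p + 1 ≤ M i j := by
    intro h0
    by_contra hlt
    exact cs.not_isReduced_alternatingWord j i (by rwa [M.symmetric j i])
      (by rw [M.symmetric j i]; omega) hred
  obtain ⟨a, h0, h1, ha, hpos, -⟩ := exists_coeff (M.off_diagonal i j hij)
  have hp0 : 0 ≤ a p := hpos p fun h => by have := hbound h; omega
  have hp1' : 0 ≤ a (p + 1) := hpos (p + 1) hbound
  rw [hwvu, rep_mul_apply, hu, rep_wordProd, alternatingWord_root M h0 h1 ha]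
  split_ifs <;> rw [map_add, map_smul, map_smul] <;>
    exact add_nonneg (smul_nonneg (by assumption) (by assumption))
      (smul_nonneg (by assumption) (by assumption))

lemma rep_mul_simple_root (w : W) (i : B) :
    rep cs (w * cs.simple i) (root i) = -rep cs w (root i) := by
  rw [rep_mul_apply, rep_simple, refl_root_self, map_neg]

theorem rep_root_nonneg_or_nonpos (w : W) (i : B) :
    0 ≤ rep cs w (root i) ∨ rep cs w (root i) ≤ 0 := by
  rcases cs.length_mul_simple w i with h | h
  · exact Or.inl (rep_root_nonneg_of_length_lt cs w i (by omega))
  · right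
    have := rep_root_nonneg_of_length_lt cs (w * cs.simple i) i
      (by rw [mul_assoc, cs.simple_mul_simple_self, mul_one]; omega)
    rw [rep_mul_simple_root] at this
    exact neg_nonneg.1 this

theorem rep_injective : Function.Injective (rep cs) := by
  rw [injective_iff_map_eq_one]
  intro w hw
  by_contra hne
  obtain ⟨i, hi⟩ := cs.exists_rightDescent_of_ne_one hne
  have := rep_root_nonneg_of_length_lt cs (w * cs.simple i) i
    (by rw [mul_assoc, cs.simple_mul_simple_self, mul_one]; exact hi)
  rw [rep_mul_simple_root, hw, Module.End.one_apply] at this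
  have := this i
  simp [root] at this
  linarith

end Rep

section PosDef

variable {B : Type*} [Fintype B] [DecidableEq B] {M : CoxeterMatrix B} {W : Type*} [Group W]
  (cs : CoxeterSystem M W)

/-- A `W`-invariant inner product, obtained by averaging. -/
noncomputable def avgForm [Fintype W] : LinearMap.BilinForm ℝ (B → ℝ) :=
  ∑ w : W, LinearMap.BilinForm.comp (Matrix.toBilin' 1) (rep cs w) (rep cs w)

lemma avgForm_apply [Fintype W] (x y : B → ℝ) :
    avgForm cs x y = ∑ w : W, rep cs w x ⬝ᵥ rep cs w y := by
  simp [avgForm, LinearMap.sum_apply, LinearMap.BilinForm.comp_apply, Matrix.toBilin'_apply']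

lemma avgForm_comm [Fintype W] (x y : B → ℝ) : avgForm cs x y = avgForm cs y x := by
  simp only [avgForm_apply, dotProduct_comm]

lemma avgForm_rep_rep [Fintype W] (w : W) (x y : B → ℝ) :
    avgForm cs (rep cs w x) (rep cs w y) = avgForm cs x y := by
  simp only [avgForm_apply, ← rep_mul_apply]
  exact Fintype.sum_equiv (Equiv.mulRight w) _ _ fun _ => rfl

lemma avgForm_self_pos [Fintype W] {x : B → ℝ} (hx : x ≠ 0) : 0 < avgForm cs x x := by
  rw [avgForm_apply]
  refine Finset.sum_pos' (fun w _ => ?_) ⟨1, Finset.mem_univ _, ?_⟩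
  · exact Finset.sum_nonneg fun i _ => mul_self_nonneg _
  · simp only [map_one, Module.End.one_apply]
    obtain ⟨i, hi⟩ := Function.ne_iff.1 hx
    exact Finset.sum_pos' (fun i _ => mul_self_nonneg _)
      ⟨i, Finset.mem_univ _, mul_self_pos.2 hi⟩

omit [Fintype B] in
lemma root_ne_zero (i : B) : root i ≠ 0 := by
  simp [root]

lemma avgForm_root_right [Fintype W] (i : B) (x : B → ℝ) :
    avgForm cs x (root i) = form M (root i) x * avgForm cs (root i) (root i) := by
  have h := avgForm_rep_rep cs (cs.simple i) x (root i)
  rw [rep_simple, refl_root_self, refl_apply] at h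
  simp only [map_sub, map_neg, map_smul, LinearMap.sub_apply, LinearMap.smul_apply,
    smul_eq_mul] at h
  linarith

include cs in
/-- The canonical form of a finite Coxeter group is positive definite. -/
theorem form_self_pos [Finite W] {x : B → ℝ} (hx : x ≠ 0) : 0 < form M x x := by
  have := Fintype.ofFinite W
  have hI : ∀ i, 0 < avgForm cs (root i) (root i) := fun i => avgForm_self_pos cs (root_ne_zero i)
  set d : B → ℝ := fun i => √(avgForm cs (root i) (root i)) with hd
  have hdpos : ∀ i, 0 < d i := fun i => Real.sqrt_pos.2 (hI i)
  have hij : ∀ i j, form M (root i) (root j) * (d i * d j) = avgForm cs (root i) (root j) := by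
    intro i j
    have h1 := avgForm_root_right cs j (root i)
    have h2 := avgForm_root_right cs i (root j)
    rw [avgForm_comm, h1, form_comm M (root j)] at h2
    by_cases h0 : form M (root i) (root j) = 0
    · rw [h1, form_comm M (root j), h0]
      simp
    · have h3 := mul_left_cancel₀ h0 h2
      rw [h1, form_comm M (root j)]
      congr 1
      simp only [hd]
      rw [h3, Real.mul_self_sqrt (hI i).le]
  set y : B → ℝ := ∑ i, (x i / d i) • root i with hy
  have hyi : ∀ i, y i = x i / d i := by
    intro i
    simp [hy, root, Pi.single_apply]
  have hy0 : y ≠ 0 := by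
    obtain ⟨i, hi⟩ := Function.ne_iff.1 hx
    refine Function.ne_iff.2 ⟨i, ?_⟩
    rw [hyi]
    exact div_ne_zero hi (hdpos i).ne'
  have key : form M x x = avgForm cs y y := by
    rw [hy]
    conv_lhs => rw [eq_sum_root x]
    simp only [map_sum, LinearMap.sum_apply, map_smul, LinearMap.smul_apply, smul_eq_mul, Finset.mul_sum]
    refine Finset.sum_congr rfl fun i _ => Finset.sum_congr rfl fun j _ => ?_
    rw [← hij]
    have := (hdpos i).ne'
    have := (hdpos j).ne'
    field_simp
  rw [key]
  exact avgForm_self_pos cs hy0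

include cs in
lemma exists_weight [Finite W] : ∃ ω : B → B → ℝ, ∀ k x, form M (ω k) x = x k / 2 := by
  have hinj : Function.Injective (form M) := by
    rw [injective_iff_map_eq_zero]
    intro x hx
    by_contra h0
    have := form_self_pos cs h0
    rw [hx] at this
    simp at this
  have hsurj : Function.Surjective (form M) :=
    (LinearMap.injective_iff_surjective_of_finrank_eq_finrank
      (Subspace.dual_finrank_eq (K := ℝ) (V := B → ℝ)).symm).1 hinj
  choose ω hω using fun k : B => hsurj ((2⁻¹ : ℝ) • LinearMap.proj k)
  refine ⟨ω, fun k x => ?_⟩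
  rw [hω]
  simp
  ring

/-- The fundamental weights, normalised by `sₖ ωₖ = ωₖ - αₖ`. -/
noncomputable def weight [Finite W] (k : B) : B → ℝ := (exists_weight cs).choose k

lemma form_weight [Finite W] (k : B) (x : B → ℝ) : form M (weight cs k) x = x k / 2 :=
  (exists_weight cs).choose_spec k x

lemma refl_weight_self [Finite W] (k : B) : refl M k (weight cs k) = weight cs k - root k := by
  rw [refl_apply, form_comm, form_weight]
  simp [root]

lemma refl_weight_of_ne [Finite W] {i k : B} (h : i ≠ k) :
    refl M i (weight cs k) = weight cs k := by
  rw [refl_apply, form_comm, form_weight]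
  simp [root, h.symm]

end PosDef

section Roots

variable {B : Type*} [Fintype B] [DecidableEq B] {M : CoxeterMatrix B} {W : Type*} [Group W]
  (cs : CoxeterSystem M W)

lemma rep_conj_simple_apply (w : W) (i : B) (x : B → ℝ) :
    rep cs (w * cs.simple i * w⁻¹) x =
      x - (2 * form M (rep cs w (root i)) x) • rep cs w (root i) := by
  rw [rep_mul_apply, rep_mul_apply, rep_simple, refl_apply, map_sub, map_smul, rep_rep_inv,
    form_rep_left]

lemma conj_simple_eq {u v : W} {i j : B} (h : rep cs u (root i) = rep cs v (root j)) :
    u * cs.simple i * u⁻¹ = v * cs.simple j * v⁻¹ := by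
  apply rep_injective cs
  refine LinearMap.ext fun x => ?_
  rw [rep_conj_simple_apply, rep_conj_simple_apply, h]

lemma form_rep_root_self (w : W) (i : B) :
    form M (rep cs w (root i)) (rep cs w (root i)) = 1 := by
  rw [form_rep_rep, form_root_self]

lemma rep_root_ne_zero (w : W) (i : B) : rep cs w (root i) ≠ 0 := by
  intro h
  have := form_rep_root_self cs w i
  rw [h] at this
  simp at this

lemma refl_apply_of_ne {i j : B} (h : j ≠ i) (x : B → ℝ) : refl M i x j = x j := by
  simp [refl_apply, root, h]

lemma eq_root_of_refl_nonpos {w : W} {i j : B} (h0 : 0 ≤ rep cs w (root j))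
    (h1 : refl M i (rep cs w (root j)) ≤ 0) : rep cs w (root j) = root i := by
  set β := rep cs w (root j) with hβ
  have hsupp : ∀ k, k ≠ i → β k = 0 := fun k hk =>
    le_antisymm (by simpa [refl_apply_of_ne hk] using h1 k) (h0 k)
  have hβi : β = β i • root i := by
    ext k
    by_cases hk : k = i
    · subst hk
      simp [root]
    · simp [root, hk, hsupp k hk]
  have hn : form M β β = 1 := form_rep_root_self cs w j
  rw [hβi] at hn
  simp only [map_smul, LinearMap.smul_apply, form_root_self, smul_eq_mul, mul_one] at hn
  have h2 : β i = 1 := by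
    have := h0 i
    simp only [Pi.zero_apply] at this
    nlinarith
  rw [hβi, h2, one_smul]

/-- If a word makes a positive root negative, then one of its letters does so. -/
lemma exists_split_of_nonpos {w : W} {j : B} (h0 : 0 ≤ rep cs w (root j)) (l : List B)
    (h1 : rep cs (cs.wordProd l * w) (root j) ≤ 0) :
    ∃ a i b, l = a ++ i :: b ∧ rep cs (cs.wordProd b * w) (root j) = root i := by
  induction l with
  | nil =>
    rw [cs.wordProd_nil, one_mul] at h1
    exact absurd (le_antisymm h1 h0) (rep_root_ne_zero cs w j)
  | cons i l ih =>
    rcases rep_root_nonneg_or_nonpos cs (cs.wordProd l * w) j with h | h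
    · refine ⟨[], i, l, rfl, eq_root_of_refl_nonpos cs h ?_⟩
      rwa [cs.wordProd_cons, mul_assoc, rep_mul_apply, rep_simple] at h1
    · obtain ⟨a, k, b, rfl, hk⟩ := ih h
      exact ⟨i :: a, k, b, rfl, hk⟩

/-- The standard parabolic subgroup generated by the simple reflections indexed by `J`. -/
def stdParabolic (J : Set B) : Subgroup W := Subgroup.closure (cs.simple '' J)

omit [Fintype B] [DecidableEq B] in
lemma simple_mem_stdParabolic {J : Set B} {j : B} (hj : j ∈ J) :
    cs.simple j ∈ stdParabolic cs J :=
  Subgroup.subset_closure ⟨j, hj, rfl⟩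

omit [Fintype B] [DecidableEq B] in
lemma wordProd_mem_stdParabolic {J : Set B} {l : List B} (hl : ∀ j ∈ l, j ∈ J) :
    cs.wordProd l ∈ stdParabolic cs J := by
  refine Subgroup.list_prod_mem _ fun x hx => ?_
  obtain ⟨j, hj, rfl⟩ := List.mem_map.1 hx
  exact simple_mem_stdParabolic cs (hl j hj)

omit [Fintype B] [DecidableEq B] in
lemma exists_word_of_mem_stdParabolic {J : Set B} {w : W} (hw : w ∈ stdParabolic cs J) :
    ∃ l : List B, (∀ j ∈ l, j ∈ J) ∧ cs.wordProd l = w := by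
  induction hw using Subgroup.closure_induction with
  | mem x hx =>
    obtain ⟨j, hj, rfl⟩ := hx
    exact ⟨[j], by simpa using hj, by simp⟩
  | one => exact ⟨[], by simp, by simp⟩
  | mul x y _ _ hx hy =>
    obtain ⟨l, hl, rfl⟩ := hx
    obtain ⟨l', hl', rfl⟩ := hy
    refine ⟨l ++ l', fun j hj => ?_, cs.wordProd_append l l'⟩
    rcases List.mem_append.1 hj with h | h
    exacts [hl j h, hl' j h]
  | inv x _ hx =>
    obtain ⟨l, hl, rfl⟩ := hx
    exact ⟨l.reverse, fun j hj => hl j (List.mem_reverse.1 hj), cs.wordProd_reverse l⟩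

/-- Induction along words in `J` all of whose prefixes map the next simple root to a
positive root. -/
theorem stdParabolic_induction {J : Set B} {P : W → Prop} (one : P 1)
    (mul_simple : ∀ w ∈ stdParabolic cs J, ∀ j ∈ J, 0 ≤ rep cs w (root j) → P w →
      P (w * cs.simple j))
    {w : W} (hw : w ∈ stdParabolic cs J) : P w := by
  obtain ⟨l, hl, rfl⟩ := exists_word_of_mem_stdParabolic cs hw
  clear hw
  induction hn : l.length using Nat.strong_induction_on generalizing l with
  | _ n ih =>
  subst hn
  rcases List.eq_nil_or_concat l with rfl | ⟨l', j, rfl⟩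
  · simpa using one
  simp only [List.concat_eq_append, List.mem_append, List.mem_singleton] at hl
  rw [cs.wordProd_concat]
  rcases rep_root_nonneg_or_nonpos cs (cs.wordProd l') j with h | h
  · exact mul_simple _ (wordProd_mem_stdParabolic cs fun i hi => hl i (Or.inl hi)) j
      (hl j (Or.inr rfl)) h (ih l'.length (by simp) l' (fun i hi => hl i (Or.inl hi)) rfl)
  · have h0 : 0 ≤ rep cs (1 : W) (root j) := by
      simp [root]
    obtain ⟨a, i, b, rfl, hb⟩ := exists_split_of_nonpos cs h0 l' (by rwa [mul_one])
    rw [mul_one] at hb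
    have hcomm : cs.wordProd b * cs.simple j = cs.simple i * cs.wordProd b := by
      have := conj_simple_eq cs (u := cs.wordProd b) (v := 1) (i := j) (j := i)
        (by simpa using hb)
      rw [mul_inv_eq_iff_eq_mul] at this
      simpa using this
    have e : cs.wordProd (a ++ i :: b) * cs.simple j = cs.wordProd (a ++ b) := by
      rw [cs.wordProd_append, cs.wordProd_cons, cs.wordProd_append, mul_assoc, mul_assoc, hcomm,
        cs.simple_mul_simple_cancel_left]
    rw [e]
    refine ih _ (by simp) (a ++ b) (fun k hk => hl k (Or.inl ?_)) rfl
    simp only [List.mem_append, List.mem_cons] at hk ⊢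
    tauto

/-- The span of the simple roots indexed by `J`. -/
def supp (J : Set B) : Submodule ℝ (B → ℝ) where
  carrier := {x | ∀ i ∉ J, x i = 0}
  add_mem' hx hy i hi := by simp [hx i hi, hy i hi]
  zero_mem' i _ := rfl
  smul_mem' a x hx i hi := by simp [hx i hi]

omit [Fintype B] in
lemma root_mem_supp {J : Set B} {j : B} (hj : j ∈ J) : root j ∈ supp J := by
  intro i hi
  have : i ≠ j := fun h => hi (h ▸ hj)
  simp [root, this]

lemma rep_mem_supp {J : Set B} {w : W} (hw : w ∈ stdParabolic cs J) {x : B → ℝ}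
    (hx : x ∈ supp J) : rep cs w x ∈ supp J := by
  induction hw using Subgroup.closure_induction_left generalizing x with
  | one => simpa using hx
  | mul_left g hg y _ ih =>
    obtain ⟨j, hj, rfl⟩ := hg
    rw [rep_mul_apply, rep_simple, refl_apply]
    exact sub_mem (ih hx) (Submodule.smul_mem _ _ (root_mem_supp hj))
  | inv_mul_cancel g hg y _ ih =>
    obtain ⟨j, hj, rfl⟩ := hg
    rw [cs.inv_simple, rep_mul_apply, rep_simple, refl_apply]
    exact sub_mem (ih hx) (Submodule.smul_mem _ _ (root_mem_supp hj))

lemma rep_sub_mem_supp {J : Set B} {w : W} (hw : w ∈ stdParabolic cs J) (x : B → ℝ) :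
    rep cs w x - x ∈ supp J := by
  induction hw using Subgroup.closure_induction_left generalizing x with
  | one => simp
  | mul_left g hg y _ ih =>
    obtain ⟨j, hj, rfl⟩ := hg
    rw [rep_mul_apply, rep_simple, refl_apply, sub_right_comm]
    exact sub_mem (ih x) (Submodule.smul_mem _ _ (root_mem_supp hj))
  | inv_mul_cancel g hg y _ ih =>
    obtain ⟨j, hj, rfl⟩ := hg
    rw [cs.inv_simple, rep_mul_apply, rep_simple, refl_apply, sub_right_comm]
    exact sub_mem (ih x) (Submodule.smul_mem _ _ (root_mem_supp hj))

lemma form_eq_sum (v x : B → ℝ) : form M v x = ∑ i, x i * form M v (root i) := by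
  conv_lhs => rw [eq_sum_root x]
  simp

/-- The stabiliser in `W_J` of a `J`-dominant vector is a standard parabolic subgroup. -/
theorem mem_stdParabolic_of_rep_eq {J : Set B} {v : B → ℝ}
    (hv : ∀ j ∈ J, 0 ≤ form M v (root j)) {w : W} (hw : w ∈ stdParabolic cs J)
    (hwv : rep cs w v = v) : w ∈ stdParabolic cs {j ∈ J | form M v (root j) = 0} := by
  revert hwv
  refine stdParabolic_induction cs (P := fun w => rep cs w v = v → _) ?_ ?_ hw
  · exact fun _ => one_mem _
  · intro w hw j hj h0 ih hfix
    have h1 : form M v (root j) = -form M v (rep cs w (root j)) := by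
      rw [← form_rep_rep cs (w * cs.simple j), hfix, rep_mul_simple_root, map_neg]
    have h2 : 0 ≤ form M v (rep cs w (root j)) := by
      rw [form_eq_sum]
      refine Finset.sum_nonneg fun i _ => ?_
      by_cases hi : i ∈ J
      · exact mul_nonneg (h0 i) (hv i hi)
      · simp [rep_mem_supp cs hw (root_mem_supp hj) i hi]
    have h3 : form M v (root j) = 0 := le_antisymm (by linarith) (hv j hj)
    have h4 : refl M j v = v := by
      rw [refl_apply, form_comm, h3]
      simp
    rw [rep_mul_apply, rep_simple, h4] at hfix
    exact mul_mem (ih hfix) (simple_mem_stdParabolic cs ⟨hj, h3⟩)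

omit [Fintype B] [DecidableEq B] in
lemma stdParabolic_univ : stdParabolic cs Set.univ = ⊤ := by
  rw [stdParabolic, Set.image_univ, cs.subgroup_closure_range_simple]

lemma rep_weight_le [Finite W] (w : W) (k : B) : rep cs w (weight cs k) ≤ weight cs k := by
  have hw : w ∈ stdParabolic cs Set.univ := by simp [stdParabolic_univ]
  refine stdParabolic_induction cs (P := fun w => rep cs w (weight cs k) ≤ weight cs k) ?_ ?_ hw
  · simp
  · intro w _ j _ h0 ih
    rw [rep_mul_apply, rep_simple]
    by_cases hjk : j = k
    · subst hjk
      rw [refl_weight_self, map_sub]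
      exact (sub_le_self _ h0).trans ih
    · rwa [refl_weight_of_ne cs hjk]

lemma weight_injective [Finite W] : Function.Injective (weight cs) := by
  intro i j h
  have h1 := form_weight cs i (root i)
  have h2 := form_weight cs j (root i)
  rw [← h, h1] at h2
  by_contra hij
  simp [root, Ne.symm hij] at h2

lemma eq_of_rep_weight_eq [Finite W] {w : W} {i j : B}
    (h : rep cs w (weight cs i) = weight cs j) : i = j := by
  apply weight_injective cs
  apply le_antisymm
  · have := rep_weight_le cs w⁻¹ j
    rwa [← h, rep_inv_rep, h] at this
  · rw [← h]
    exact rep_weight_le cs w i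

/-- Every vector can be moved to a `J`-dominant one by an element of `W_J`. -/
theorem exists_dominant [Finite W] (J : Set B) (v : B → ℝ) :
    ∃ u ∈ stdParabolic cs J, ∀ j ∈ J, 0 ≤ form M (rep cs u v) (root j) := by
  set ρ : B → ℝ := ∑ k, weight cs k with hρ
  have hρj : ∀ j, form M ρ (root j) = 1 / 2 := by
    intro j
    simp [hρ, LinearMap.sum_apply, form_weight, root, Pi.single_apply, ite_div]
  obtain ⟨u, hu, hmax⟩ := Set.exists_max_image (stdParabolic cs J : Set W)
    (fun u => form M ρ (rep cs u v)) (Set.toFinite _) ⟨1, one_mem _⟩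
  refine ⟨u, hu, fun j hj => ?_⟩
  have := hmax (cs.simple j * u) (mul_mem (simple_mem_stdParabolic cs hj) hu)
  simp only [rep_mul_apply, rep_simple, refl_apply, map_sub, map_smul, hρj, smul_eq_mul] at this
  rw [form_comm]
  linarith

end Roots

section AbsoluteLength

variable {B : Type*} [Fintype B] [DecidableEq B] {M : CoxeterMatrix B} {W : Type*} [Group W]
  (cs : CoxeterSystem M W)

/-- The space of vectors fixed by `w`. -/
noncomputable def fixSpace (w : W) : Submodule ℝ (B → ℝ) := LinearMap.ker (rep cs w - 1)

lemma mem_fixSpace {w : W} {x : B → ℝ} : x ∈ fixSpace cs w ↔ rep cs w x = x := by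
  rw [fixSpace, LinearMap.mem_ker, LinearMap.sub_apply, Module.End.one_apply, sub_eq_zero]

/-- The codimension of the space of vectors fixed by `w`. -/
noncomputable def cod (w : W) : ℕ := Fintype.card B - Module.finrank ℝ (fixSpace cs w)

lemma finrank_fixSpace_le (w : W) : Module.finrank ℝ (fixSpace cs w) ≤ Fintype.card B := by
  simpa using Submodule.finrank_le (fixSpace cs w)

lemma cod_add_finrank (w : W) :
    cod cs w + Module.finrank ℝ (fixSpace cs w) = Fintype.card B :=
  Nat.sub_add_cancel (finrank_fixSpace_le cs w)

lemma cod_eq_card {w : W} (h : ∀ x, rep cs w x = x → x = 0) : cod cs w = Fintype.card B := by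
  have : fixSpace cs w = ⊥ := by
    rw [Submodule.eq_bot_iff]
    exact fun x hx => h x ((mem_fixSpace cs).1 hx)
  rw [cod, this, finrank_bot, Nat.sub_zero]

lemma cod_eq_zero_iff {w : W} : cod cs w = 0 ↔ w = 1 := by
  have hc := cod_add_finrank cs w
  constructor
  · intro h
    have htop : fixSpace cs w = ⊤ := by
      apply Submodule.eq_top_of_finrank_eq
      simp
      omega
    apply rep_injective cs
    refine LinearMap.ext fun x => ?_
    rw [map_one, Module.End.one_apply]
    exact (mem_fixSpace cs).1 (htop ▸ Submodule.mem_top)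
  · rintro rfl
    have htop : fixSpace cs (1 : W) = ⊤ := by
      simp [fixSpace]
    rw [cod, htop]
    simp

lemma fixSpace_inf_le (u v : W) : fixSpace cs u ⊓ fixSpace cs v ≤ fixSpace cs (u * v) := by
  rintro x ⟨hu, hv⟩
  rw [SetLike.mem_coe, mem_fixSpace] at hu hv
  rw [mem_fixSpace, rep_mul_apply, hv, hu]

lemma card_le_finrank_inf_add_cod (u v : W) : Fintype.card B ≤
    Module.finrank ℝ ↥(fixSpace cs u ⊓ fixSpace cs v) + cod cs u + cod cs v := by
  have h1 := Submodule.finrank_sup_add_finrank_inf_eq (fixSpace cs u) (fixSpace cs v)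
  have h2 : Module.finrank ℝ ↥(fixSpace cs u ⊔ fixSpace cs v) ≤ Fintype.card B := by
    simpa using Submodule.finrank_le (fixSpace cs u ⊔ fixSpace cs v)
  have h3 := cod_add_finrank cs u
  have h4 := cod_add_finrank cs v
  omega

lemma cod_mul_le (u v : W) : cod cs (u * v) ≤ cod cs u + cod cs v := by
  have h1 := card_le_finrank_inf_add_cod cs u v
  have h2 := Submodule.finrank_mono (fixSpace_inf_le cs u v)
  have h3 := cod_add_finrank cs (u * v)
  omega

lemma finrank_fixSpace_le_conj (g w : W) :
    Module.finrank ℝ (fixSpace cs w) ≤ Module.finrank ℝ (fixSpace cs (g * w * g⁻¹)) := by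
  have hinj : Function.Injective (rep cs g) :=
    Function.LeftInverse.injective (rep_inv_rep cs g)
  rw [(Submodule.equivMapOfInjective (rep cs g) hinj (fixSpace cs w)).finrank_eq]
  apply Submodule.finrank_mono
  rintro _ ⟨x, hx, rfl⟩
  rw [SetLike.mem_coe, mem_fixSpace] at hx
  rw [mem_fixSpace, rep_mul_apply, rep_mul_apply, rep_inv_rep, hx]

lemma cod_conj (g w : W) : cod cs (g * w * g⁻¹) = cod cs w := by
  have h1 := finrank_fixSpace_le_conj cs g w
  have h2 := finrank_fixSpace_le_conj cs g⁻¹ (g * w * g⁻¹)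
  have e : g⁻¹ * (g * w * g⁻¹) * g⁻¹⁻¹ = w := by group
  rw [e] at h2
  rw [cod, cod, le_antisymm h2 h1]

lemma cod_simple_le (i : B) : cod cs (cs.simple i) ≤ 1 := by
  have h1 : LinearMap.ker (form M (root i)) ≤ fixSpace cs (cs.simple i) := by
    intro x hx
    rw [LinearMap.mem_ker] at hx
    rw [mem_fixSpace, rep_simple, refl_apply, hx]
    simp
  have h2 := Submodule.finrank_mono h1
  have h3 := LinearMap.finrank_range_add_finrank_ker (form M (root i))
  have h4 : Module.finrank ℝ (LinearMap.range (form M (root i))) ≤ 1 := by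
    simpa using Submodule.finrank_le (LinearMap.range (form M (root i)))
  have h5 := cod_add_finrank cs (cs.simple i)
  simp only [Module.finrank_fintype_fun_eq_card] at h3
  omega

omit [Fintype B] [DecidableEq B] in
lemma simple_ne_one (i : B) : cs.simple i ≠ 1 := by
  intro h
  have := cs.length_simple i
  rw [h, cs.length_one] at this
  omega

lemma cod_simple (i : B) : cod cs (cs.simple i) = 1 := by
  have h1 := cod_simple_le cs i
  have h2 := (cod_eq_zero_iff cs).not.2 (simple_ne_one cs i)
  omega

lemma cod_prod_le {l : List W} (hl : ∀ t ∈ l, ∃ g : W, ∃ j : B, t = g * cs.simple j * g⁻¹) :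
    cod cs l.prod ≤ l.length := by
  induction l with
  | nil => exact ((cod_eq_zero_iff cs).2 rfl).le
  | cons t l ih =>
    obtain ⟨g, j, ht⟩ := hl t (by simp)
    have h1 := cod_mul_le cs t l.prod
    have h2 := ih fun t ht => hl t (by simp [ht])
    rw [ht, cod_conj, cod_simple, ← ht] at h1
    rw [List.prod_cons, List.length_cons]
    omega

/-- If `αⱼ = w v - v`, then `sⱼ w` fixes more vectors than `w`. -/
lemma finrank_fixSpace_lt {w : W} {v : B → ℝ} {j : B} (hv : rep cs w v - v = root j) :
    Module.finrank ℝ (fixSpace cs w) < Module.finrank ℝ (fixSpace cs (cs.simple j * w)) := by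
  have hwv : rep cs w v = v + root j := by rw [← hv]; abel
  apply Submodule.finrank_lt_finrank_of_lt
  rw [SetLike.lt_iff_le_and_exists]
  refine ⟨fun y hy => ?_, v, ?_, fun h => ?_⟩
  · rw [mem_fixSpace] at hy
    have h0 : form M (root j) y = 0 := by
      rw [← hv, map_sub, LinearMap.sub_apply, form_rep_left, ← hy, rep_inv_rep, hy, sub_self]
    rw [mem_fixSpace, rep_mul_apply, hy, rep_simple, refl_apply, h0]
    simp
  · have h1 := form_rep_rep cs w v v
    rw [hwv] at h1
    simp only [map_add, LinearMap.add_apply, form_root_self, form_comm M v (root j)] at h1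
    have h2 : form M (root j) (v + root j) = 1 / 2 := by
      rw [map_add, form_root_self]
      linarith
    rw [mem_fixSpace, rep_mul_apply, hwv, rep_simple, refl_apply, h2]
    simp
  · rw [mem_fixSpace] at h
    rw [h, sub_self] at hv
    exact root_ne_zero j hv.symm

/-- Carter's lemma: every element `w` of `W_J` is a product of `cod w` reflections of `W_J`. -/
theorem exists_reflection_word [Finite W] (J : Finset B) {w : W}
    (hw : w ∈ stdParabolic cs (J : Set B)) :
    ∃ l : List W, (∀ t ∈ l, ∃ g ∈ stdParabolic cs (J : Set B), ∃ j ∈ J,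
      t = g * cs.simple j * g⁻¹) ∧ l.prod = w ∧ l.length ≤ cod cs w := by
  induction J using Finset.strongInduction generalizing w with
  | H J ihJ =>
  induction hn : cod cs w using Nat.strong_induction_on generalizing w with
  | _ n ihn =>
  subst hn
  by_cases hfix : ∃ v ∈ supp (J : Set B), v ≠ 0 ∧ rep cs w v = v
  · obtain ⟨v, hvJ, hv0, hwv⟩ := hfix
    obtain ⟨u, hu, hdom⟩ := exists_dominant cs (J : Set B) v
    set J' := J.filter fun j => form M (rep cs u v) (root j) = 0 with hJ'
    have hsub : J' ⊂ J := by
      refine Finset.filter_ssubset.2 ?_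
      by_contra hcon
      push Not at hcon
      have hself : form M (rep cs u v) (rep cs u v) = 0 := by
        rw [form_eq_sum]
        refine Finset.sum_eq_zero fun i _ => ?_
        by_cases hi : i ∈ J
        · rw [hcon i hi, mul_zero]
        · rw [rep_mem_supp cs hu hvJ i (by simpa using hi), zero_mul]
      rw [form_rep_rep] at hself
      exact (form_self_pos cs hv0).ne' hself
    have hmem : u * w * u⁻¹ ∈ stdParabolic cs (J' : Set B) := by
      have := mem_stdParabolic_of_rep_eq cs hdom (w := u * w * u⁻¹)
        (mul_mem (mul_mem hu hw) (inv_mem hu))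
        (by rw [rep_mul_apply, rep_mul_apply, rep_inv_rep, hwv])
      simpa [hJ'] using this
    obtain ⟨l, hl, hprod, hlen⟩ := ihJ J' hsub hmem
    have hmono : stdParabolic cs (J' : Set B) ≤ stdParabolic cs (J : Set B) :=
      Subgroup.closure_mono (Set.image_mono (by exact_mod_cast hsub.subset))
    refine ⟨l.map (MulAut.conj u⁻¹), fun t ht => ?_, ?_, ?_⟩
    · obtain ⟨t', ht', rfl⟩ := List.mem_map.1 ht
      obtain ⟨g, hg, j, hj, rfl⟩ := hl t' ht'
      refine ⟨u⁻¹ * g, mul_mem (inv_mem hu) (hmono hg), j, hsub.subset hj, ?_⟩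
      simp only [MulAut.conj_apply]
      group
    · rw [List.prod_hom, hprod, MulAut.conj_apply]
      group
    · rw [cod_conj] at hlen
      simpa using hlen
  · push Not at hfix
    by_cases hw1 : w = 1
    · exact ⟨[], by simp, by simp [hw1], by simp⟩
    have hJ : J.Nonempty := by
      by_contra h
      rw [Finset.not_nonempty_iff_eq_empty] at h
      subst h
      simp [stdParabolic] at hw
      exact hw1 hw
    obtain ⟨j, hj⟩ := hJ
    have hmaps : ∀ x ∈ supp (J : Set B), (rep cs w - 1) x ∈ supp (J : Set B) :=
      fun x _ => rep_sub_mem_supp cs hw x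
    have hinj : Function.Injective ((rep cs w - 1).restrict hmaps) := by
      rw [injective_iff_map_eq_zero]
      intro x hx
      by_contra hx0
      apply hfix x x.2 (by simpa using hx0)
      have := congrArg Subtype.val hx
      simpa [sub_eq_zero] using this
    obtain ⟨v, hv⟩ := LinearMap.injective_iff_surjective.1 hinj
      ⟨root j, root_mem_supp (by exact_mod_cast hj)⟩
    have hv' : rep cs w v - v = root j := by
      simpa using congrArg Subtype.val hv
    have hlt := finrank_fixSpace_lt cs hv'
    have h1 := cod_add_finrank cs w
    have h2 := cod_add_finrank cs (cs.simple j * w)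
    obtain ⟨l, hl, hprod, hlen⟩ := ihn (cod cs (cs.simple j * w)) (by omega)
      (mul_mem (simple_mem_stdParabolic cs (by exact_mod_cast hj)) hw) rfl
    refine ⟨cs.simple j :: l, ?_, ?_, ?_⟩
    · intro t ht
      rcases List.mem_cons.1 ht with rfl | ht
      · exact ⟨1, one_mem _, j, hj, by simp⟩
      · exact hl t ht
    · rw [List.prod_cons, hprod, cs.simple_mul_simple_cancel_left]
    · rw [List.length_cons]
      omega

lemma absLength_eq_of {G : Type*} [Group G] {S : Set G} {w : G} {n : ℕ}
    (h1 : ∀ l : List G, (∀ t ∈ l, IsReflectionOf S t) → l.prod = w → n ≤ l.length)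
    (h2 : ∃ l : List G, (∀ t ∈ l, IsReflectionOf S t) ∧ l.prod = w ∧ l.length ≤ n) :
    absLength S w = n := by
  obtain ⟨l, hl, hp, hlen⟩ := h2
  have hmem : l.length ∈ {k | ∃ l : List G, (∀ t ∈ l, IsReflectionOf S t) ∧ l.length = k ∧
      l.prod = w} := ⟨l, hl, rfl, hp⟩
  apply le_antisymm
  · exact (Nat.sInf_le hmem).trans hlen
  · refine le_csInf ⟨_, hmem⟩ ?_
    rintro _ ⟨l', hl', rfl, hp'⟩
    exact h1 l' hl' hp'

omit [Fintype B] [DecidableEq B] in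
lemma isReflectionOf_simpleSet {t : W} :
    IsReflectionOf (simpleSet cs) t ↔ ∃ g : W, ∃ j : B, t = g * cs.simple j * g⁻¹ := by
  simp [IsReflectionOf, simpleSet]

theorem absLength_simpleSet [Finite W] (w : W) : absLength (simpleSet cs) w = cod cs w := by
  apply absLength_eq_of
  · rintro l hl rfl
    exact cod_prod_le cs fun t ht => (isReflectionOf_simpleSet cs).1 (hl t ht)
  · obtain ⟨l, hl, hp, hlen⟩ := exists_reflection_word cs Finset.univ (w := w)
      (by simp [stdParabolic_univ])
    refine ⟨l, fun t ht => ?_, hp, hlen⟩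
    obtain ⟨g, -, j, -, h⟩ := hl t ht
    exact (isReflectionOf_simpleSet cs).2 ⟨g, j, h⟩

lemma isReflectionOf_iff_cod [Finite W] {t : W} :
    IsReflectionOf (simpleSet cs) t ↔ cod cs t = 1 := by
  constructor
  · intro h
    obtain ⟨g, j, rfl⟩ := (isReflectionOf_simpleSet cs).1 h
    rw [cod_conj, cod_simple]
  · intro h
    obtain ⟨l, hl, hp, hlen⟩ := exists_reflection_word cs Finset.univ (w := t)
      (by simp [stdParabolic_univ])
    have hle := cod_prod_le cs (l := l) fun t ht => by
      obtain ⟨g, -, j, -, h⟩ := hl t ht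
      exact ⟨g, j, h⟩
    rw [hp] at hle
    obtain ⟨x, rfl⟩ := List.length_eq_one_iff.1 (by omega : l.length = 1)
    rw [List.prod_singleton] at hp
    subst hp
    obtain ⟨g, -, j, -, h⟩ := hl x (by simp)
    exact (isReflectionOf_simpleSet cs).2 ⟨g, j, h⟩

lemma simple_injective : Function.Injective cs.simple := by
  intro i j h
  have h1 : refl M j (root i) = -root i := by
    rw [← rep_simple cs, ← h, rep_simple, refl_root_self]
  by_contra hij
  have h2 := congrFun h1 i
  rw [refl_apply_of_ne hij] at h2
  simp [root] at h2
  linarith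

lemma parabolic_eq_stdParabolic (s : B) : parabolic cs s = stdParabolic cs {s}ᶜ := by
  rw [parabolic, stdParabolic, Set.compl_eq_univ_sdiff, Set.image_sdiff (simple_injective cs),
    Set.image_univ, Set.image_singleton]

theorem absLength_parabolicGens [Finite W] (s : B) (d : parabolic cs s) :
    absLength (parabolicGens cs s) d = cod cs (d : W) := by
  apply absLength_eq_of
  · rintro l hl rfl
    have := cod_prod_le cs (l := l.map (parabolic cs s).subtype) fun t ht => by
      obtain ⟨t', ht', rfl⟩ := List.mem_map.1 ht
      obtain ⟨g, x, hx, rfl⟩ := hl t' ht'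
      obtain ⟨⟨j, hj⟩, -⟩ := hx
      exact ⟨g, j, by simp [hj]⟩
    rwa [List.prod_hom, List.length_map] at this
  · have hset : (((Finset.univ.erase s : Finset B) : Set B)) = {s}ᶜ := by
      ext
      simp
    obtain ⟨l, hl, hp, hlen⟩ := exists_reflection_word cs (Finset.univ.erase s) (w := (d : W))
      (by rw [hset, ← parabolic_eq_stdParabolic]; exact d.2)
    have hl' : ∀ t ∈ l, ∃ t' : parabolic cs s, (t' : W) = t ∧
        IsReflectionOf (parabolicGens cs s) t' := by
      intro t ht
      obtain ⟨g, hg, j, hj, rfl⟩ := hl t ht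
      rw [hset, ← parabolic_eq_stdParabolic] at hg
      have hjs : j ≠ s := by simpa using hj
      have hjm : cs.simple j ∈ Set.range cs.simple \ {cs.simple s} :=
        ⟨⟨j, rfl⟩, fun h => hjs (simple_injective cs h)⟩
      have hjp : cs.simple j ∈ parabolic cs s := Subgroup.subset_closure hjm
      exact ⟨⟨g, hg⟩ * ⟨cs.simple j, hjp⟩ * ⟨g, hg⟩⁻¹, rfl, ⟨g, hg⟩, ⟨cs.simple j, hjp⟩, hjm, rfl⟩
    choose! f hf using hl'
    refine ⟨l.map f, fun t ht => ?_, ?_, by simpa using hlen⟩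
    · obtain ⟨t', ht', rfl⟩ := List.mem_map.1 ht
      exact (hf t' ht').2
    · apply Subtype.ext
      rw [← hp, Subgroup.val_list_prod, List.map_map]
      congr 1
      conv_rhs => rw [← List.map_id l]
      exact List.map_congr_left fun t ht => (hf t ht).1

/-- Elements below an element of a standard parabolic subgroup belong to this subgroup. -/
theorem mem_stdParabolic_of_cod_add [Finite W] {J : Set B} {u w : W}
    (hw : w ∈ stdParabolic cs J) (h : cod cs u + cod cs (u⁻¹ * w) = cod cs w) :
    u ∈ stdParabolic cs J := by
  classical
  have hfix : fixSpace cs w ≤ fixSpace cs u := by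
    have h1 := card_le_finrank_inf_add_cod cs u (u⁻¹ * w)
    have h2 := fixSpace_inf_le cs u (u⁻¹ * w)
    rw [mul_inv_cancel_left] at h2
    have h3 := cod_add_finrank cs w
    have h4 := Submodule.eq_of_le_of_finrank_le h2 (by omega)
    rw [← h4]
    exact inf_le_left
  set v : B → ℝ := ∑ k, if k ∈ J then 0 else weight cs k with hv
  have hvj : ∀ j, form M v (root j) = if j ∈ J then 0 else 1 / 2 := by
    intro j
    simp only [hv, map_sum, LinearMap.sum_apply]
    rw [Finset.sum_eq_single j]
    · split_ifs <;> simp [form_weight, root]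
    · intro k _ hk
      split_ifs <;> simp [form_weight, root, hk]
    · simp
  have hset : {j ∈ (Set.univ : Set B) | form M v (root j) = 0} = J := by
    ext j
    simp [hvj]
  have hdom : ∀ j ∈ (Set.univ : Set B), 0 ≤ form M v (root j) := by
    intro j _
    rw [hvj]
    split_ifs <;> norm_num
  have hwv : rep cs w v = v := by
    obtain ⟨l, hl, rfl⟩ := exists_word_of_mem_stdParabolic cs hw
    clear hw h hfix
    induction l with
    | nil => simp
    | cons j l ih =>
      rw [cs.wordProd_cons, rep_mul_apply, ih fun i hi => hl i (by simp [hi]), rep_simple,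
        refl_apply, form_comm, hvj, if_pos (hl j (by simp))]
      simp
  have huv : rep cs u v = v := (mem_fixSpace cs).1 (hfix ((mem_fixSpace cs).2 hwv))
  have := mem_stdParabolic_of_rep_eq cs hdom (w := u) (by simp [stdParabolic_univ]) huv
  rwa [hset] at this

end AbsoluteLength

section CoxeterWords

variable {B : Type*} [Fintype B] [DecidableEq B] {M : CoxeterMatrix B} {W : Type*} [Group W]
  (cs : CoxeterSystem M W)

lemma form_root_nonpos {i j : B} (hij : i ≠ j) : form M (root i) (root j) ≤ 0 := by
  rw [form_root_root, neg_nonpos]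
  apply Real.cos_nonneg_of_neg_pi_div_two_le_of_le
  · have : (0 : ℝ) ≤ Real.pi / M i j := by positivity
    linarith [Real.pi_pos]
  · rcases Nat.eq_zero_or_pos (M i j) with h | h
    · simp only [h, Nat.cast_zero, div_zero]
      positivity
    · have h2 : 2 ≤ M i j := by
        have := M.off_diagonal i j hij
        omega
      have h2' : (2 : ℝ) ≤ M i j := by exact_mod_cast h2
      exact div_le_div_of_nonneg_left Real.pi_pos.le two_pos h2'

lemma form_root_le {i j : B} (hij : i ≠ j) (h : form M (root i) (root j) ≠ 0) :
    form M (root i) (root j) ≤ -(1 / 2) := by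
  rw [form_root_root] at h ⊢
  rw [neg_le_neg_iff]
  have h1 := M.off_diagonal i j hij
  have h2 : M i j ≠ 2 := by
    intro h2
    simp [h2] at h
  rcases Nat.eq_zero_or_pos (M i j) with h0 | h0
  · norm_num [h0]
  · have h3 : (3 : ℝ) ≤ M i j := by
      have : 3 ≤ M i j := by omega
      exact_mod_cast this
    rw [← Real.cos_pi_div_three]
    apply Real.cos_le_cos_of_nonneg_of_le_pi
    · positivity
    · linarith [Real.pi_pos]
    · exact div_le_div_of_nonneg_left Real.pi_pos.le (by norm_num) h3

include cs in
/-- The Coxeter graph of a finite Coxeter group is a forest: every nonempty set of vertices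
contains a vertex with at most one neighbour in this set. -/
theorem exists_leaf [Finite W] {A : Finset B} (hA : A.Nonempty) :
    ∃ i ∈ A, ∀ j ∈ A, ∀ k ∈ A, j ≠ i → k ≠ i → form M (root i) (root j) ≠ 0 →
      form M (root i) (root k) ≠ 0 → j = k := by
  by_contra hcon
  push Not at hcon
  have hne : ∑ i ∈ A, root i ≠ 0 := by
    obtain ⟨i, hi⟩ := hA
    intro h
    have := congrFun h i
    simp [root, Finset.sum_apply, Pi.single_apply, hi] at this
  have hpos := form_self_pos cs hne
  simp only [map_sum, LinearMap.sum_apply] at hpos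
  rw [Finset.sum_comm] at hpos
  refine hpos.not_ge (Finset.sum_nonpos fun i hi => ?_)
  obtain ⟨j, hj, k, hk, hji, hki, hfj, hfk, hjk⟩ := hcon i hi
  have hj1 := form_root_le hji.symm hfj
  have hk1 := form_root_le hki.symm hfk
  rw [← Finset.add_sum_erase _ _ hi,
    ← Finset.add_sum_erase _ _ (Finset.mem_erase.2 ⟨hji, hj⟩),
    ← Finset.add_sum_erase _ _ (Finset.mem_erase.2 ⟨hjk.symm, Finset.mem_erase.2 ⟨hki, hk⟩⟩),
    form_root_self]
  have : ∑ x ∈ ((A.erase i).erase j).erase k, form M (root i) (root x) ≤ 0 := by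
    refine Finset.sum_nonpos fun x hx => form_root_nonpos ?_
    simp only [Finset.mem_erase] at hx
    exact hx.2.2.1.symm
  linarith

lemma commute_simple {i j : B} (h : form M (root i) (root j) = 0) :
    Commute (cs.simple i) (cs.simple j) := by
  apply rep_injective cs
  refine LinearMap.ext fun x => ?_
  rw [rep_mul_apply, rep_mul_apply, rep_simple, rep_simple]
  simp only [refl_apply, map_sub, map_smul, h, (form_comm M _ _).trans h, sub_zero, mul_zero,
    zero_smul]
  abel

/-- Elementary moves between words whose products are conjugate. -/
inductive WordStep (M : CoxeterMatrix B) : List B → List B → Prop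
  | rotate (a : B) (l : List B) : WordStep M (a :: l) (l ++ [a])
  | swap (l r : List B) {a b : B} (h : form M (root a) (root b) = 0) :
      WordStep M (l ++ a :: b :: r) (l ++ b :: a :: r)

lemma WordStep.perm {l l' : List B} (h : WordStep M l l') : l.Perm l' := by
  cases h with
  | rotate a l => exact (List.perm_append_singleton a l).symm
  | swap l r h => exact (List.Perm.swap _ _ _).append_left l

lemma WordStep.isConj {l l' : List B} (h : WordStep M l l') :
    IsConj (cs.wordProd l) (cs.wordProd l') := by
  cases h with
  | rotate a l =>
    rw [isConj_iff]
    refine ⟨(cs.simple a)⁻¹, ?_⟩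
    rw [cs.wordProd_cons, cs.wordProd_append, cs.wordProd_singleton]
    group
  | swap l r h =>
    rw [cs.wordProd_append, cs.wordProd_append]
    simp only [cs.wordProd_cons, ← mul_assoc (cs.simple _) (cs.simple _), (commute_simple cs h).eq]
    exact IsConj.refl _

/-- Two words related by rotations and commutations. -/
abbrev WordEquiv (M : CoxeterMatrix B) : List B → List B → Prop := Relation.EqvGen (WordStep M)

lemma WordEquiv.perm {l l' : List B} (h : WordEquiv M l l') : l.Perm l' := by
  induction h with
  | rel _ _ h => exact h.perm
  | refl _ => exact List.Perm.refl _
  | symm _ _ _ ih => exact ih.symm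
  | trans _ _ _ _ _ ih1 ih2 => exact ih1.trans ih2

lemma WordEquiv.isConj {l l' : List B} (h : WordEquiv M l l') :
    IsConj (cs.wordProd l) (cs.wordProd l') := by
  induction h with
  | rel _ _ h => exact h.isConj cs
  | refl _ => exact IsConj.refl _
  | symm _ _ _ ih => exact ih.symm
  | trans _ _ _ _ _ ih1 ih2 => exact ih1.trans ih2

lemma wordEquiv_append_comm (l m : List B) : WordEquiv M (l ++ m) (m ++ l) := by
  induction l generalizing m with
  | nil => simpa using Relation.EqvGen.refl _
  | cons a l ih =>
    refine (Relation.EqvGen.rel _ _ (WordStep.rotate a (l ++ m))).trans _ _ _ ?_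
    have := ih (m ++ [a])
    simpa using this

lemma wordEquiv_move {s : B} {m : List B} (h : ∀ x ∈ m, form M (root s) (root x) = 0)
    (l r : List B) : WordEquiv M (l ++ s :: (m ++ r)) (l ++ (m ++ s :: r)) := by
  induction m generalizing l with
  | nil => exact Relation.EqvGen.refl _
  | cons a m ih =>
    refine (Relation.EqvGen.rel _ _ (WordStep.swap l (m ++ r) (h a (by simp)))).trans _ _ _ ?_
    have := ih (fun x hx => h x (by simp [hx])) (l ++ [a])
    simpa using this

lemma WordEquiv.cons {s : B} {l l' : List B} (h : WordEquiv M l l') (hl : l.Nodup)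
    (hs : ∀ j ∈ l, ∀ k ∈ l, form M (root s) (root j) ≠ 0 → form M (root s) (root k) ≠ 0 → j = k) :
    WordEquiv M (s :: l) (s :: l') := by
  induction h with
  | rel l l' h =>
    cases h with
    | swap l r h => exact Relation.EqvGen.rel _ _ (WordStep.swap (s :: l) r h)
    | rotate a l =>
      by_cases ha : form M (root s) (root a) = 0
      · refine (wordEquiv_move (m := [a]) (by simpa using ha) [] l).trans _ _ _ ?_
        exact Relation.EqvGen.rel _ _ (WordStep.rotate a (s :: l))
      · have hl0 : ∀ x ∈ l, form M (root s) (root x) = 0 := by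
          intro x hx
          by_contra hx0
          have := hs a (by simp) x (by simp [hx]) ha hx0
          subst this
          simp [hx] at hl
        have h1 := Relation.EqvGen.rel _ _ (WordStep.rotate (M := M) s (a :: l))
        have h2 := wordEquiv_move hl0 [a] []
        have h3 := Relation.EqvGen.rel _ _ (WordStep.rotate (M := M) a (s :: l))
        simp only [List.append_nil, List.cons_append, List.nil_append] at h1 h2 h3
        exact h1.trans _ _ _ (h2.symm.trans _ _ _ h3)
  | refl _ => exact Relation.EqvGen.refl _
  | symm l l' h ih =>
    have hp := WordEquiv.perm h
    exact (ih (hp.nodup_iff.2 hl) fun j hj k hk =>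
      hs j (hp.mem_iff.1 hj) k (hp.mem_iff.1 hk)).symm
  | trans l m l' h _ ih1 ih2 =>
    have hp := WordEquiv.perm h
    exact (ih1 hl hs).trans _ _ _ (ih2 (hp.nodup_iff.1 hl) fun j hj k hk =>
      hs j (hp.mem_iff.2 hj) k (hp.mem_iff.2 hk))

include cs in
theorem wordEquiv_of_perm [Finite W] {l l' : List B} (h : l.Perm l') (hl : l.Nodup) :
    WordEquiv M l l' := by
  induction hn : l.length generalizing l l' with
  | zero =>
    obtain rfl := List.length_eq_zero_iff.1 hn
    obtain rfl := h.nil_eq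
    exact Relation.EqvGen.refl _
  | succ n ih =>
    have hne : l.toFinset.Nonempty := by
      rw [List.toFinset_nonempty_iff]
      rintro rfl
      simp at hn
    obtain ⟨s, hsl, hs⟩ := exists_leaf cs hne
    simp only [List.mem_toFinset] at hsl hs
    obtain ⟨a, b, rfl⟩ := List.append_of_mem hsl
    obtain ⟨a', b', rfl⟩ := List.append_of_mem (h.mem_iff.1 hsl)
    have h1 : WordEquiv M (a ++ s :: b) (s :: (b ++ a)) := wordEquiv_append_comm a (s :: b)
    have h2 : WordEquiv M (a' ++ s :: b') (s :: (b' ++ a')) := wordEquiv_append_comm a' (s :: b')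
    have hperm : (b ++ a).Perm (b' ++ a') :=
      List.Perm.cons_inv ((h1.perm.symm.trans h).trans h2.perm)
    have hnd := h1.perm.nodup_iff.1 hl
    have hmem : ∀ j ∈ b ++ a, j ∈ a ++ s :: b ∧ j ≠ s := fun j hj =>
      ⟨h1.perm.mem_iff.2 (List.mem_cons_of_mem _ hj), fun h => (List.nodup_cons.1 hnd).1 (h ▸ hj)⟩
    have hlen : (b ++ a).length = n := by
      simp only [List.length_append, List.length_cons] at hn ⊢
      omega
    have h3 := (ih hperm (List.nodup_cons.1 hnd).2 hlen).cons (s := s) (List.nodup_cons.1 hnd).2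
      fun j hj k hk => hs j (hmem j hj).1 k (hmem k hk).1 (hmem j hj).2 (hmem k hk).2
    exact h1.trans _ _ _ (h3.trans _ _ _ h2.symm)

theorem isConj_of_perm [Finite W] {l l' : List B} (h : l.Perm l') (hl : l.Nodup) :
    IsConj (cs.wordProd l) (cs.wordProd l') :=
  (wordEquiv_of_perm cs h hl).isConj cs

include cs in
/-- The Coxeter graph of a finite Coxeter group is bipartite. -/
theorem exists_coloring [Finite W] (A : Finset B) : ∃ ε : B → Prop, ∀ i ∈ A, ∀ j ∈ A, i ≠ j →
    form M (root i) (root j) ≠ 0 → (ε i ↔ ¬ ε j) := by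
  induction A using Finset.strongInduction with
  | H A ih =>
  rcases A.eq_empty_or_nonempty with rfl | hA
  · exact ⟨fun _ => True, by simp⟩
  obtain ⟨s, hs, hleaf⟩ := exists_leaf cs hA
  obtain ⟨ε, hε⟩ := ih _ (Finset.erase_ssubset hs)
  set δ : Prop := ∃ u ∈ A, u ≠ s ∧ form M (root s) (root u) ≠ 0 ∧ ¬ ε u with hδ
  have key : ∀ j ∈ A, s ≠ j → form M (root s) (root j) ≠ 0 → (δ ↔ ¬ ε j) := by
    intro j hj hsj hf
    constructor
    · rintro ⟨u, hu, hus, hfu, hεu⟩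
      rwa [hleaf j hj u hu hsj.symm hus hf hfu]
    · exact fun h => ⟨j, hj, hsj.symm, hf, h⟩
  refine ⟨Function.update ε s δ, fun i hi j hj hij hf => ?_⟩
  by_cases his : i = s
  · subst his
    rw [Function.update_self, Function.update_of_ne hij.symm]
    exact key j hj hij hf
  · by_cases hjs : j = s
    · subst hjs
      rw [Function.update_self, Function.update_of_ne hij]
      rw [key i hi hij.symm (by rwa [form_comm]), not_not]
    · rw [Function.update_of_ne his, Function.update_of_ne hjs]
      exact hε i (by simp [hi, his]) j (by simp [hj, hjs]) hij hf

end CoxeterWords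

section CoxeterElements

variable {B : Type*} [Fintype B] [DecidableEq B] {M : CoxeterMatrix B} {W : Type*} [Group W]
  (cs : CoxeterSystem M W)

lemma rep_wordProd_apply_of_not_mem {l : List B} {k : B} (hk : k ∉ l) (x : B → ℝ) :
    rep cs (cs.wordProd l) x k = x k := by
  induction l with
  | nil => simp
  | cons i l ih =>
    rw [List.mem_cons, not_or] at hk
    rw [cs.wordProd_cons, rep_mul_apply, rep_simple, refl_apply_of_ne hk.1, ih hk.2]

lemma form_root_eq_zero_of_rep_eq {l : List B} (hl : l.Nodup) {x : B → ℝ}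
    (h : rep cs (cs.wordProd l) x = x) : ∀ i ∈ l, form M (root i) x = 0 := by
  induction l with
  | nil => simp
  | cons i l ih =>
    obtain ⟨hi, hl⟩ := List.nodup_cons.1 hl
    have h1 : rep cs (cs.wordProd l) x = refl M i x := by
      conv_rhs => rw [← h]
      rw [cs.wordProd_cons, rep_mul_apply, rep_simple, ← Module.End.mul_apply, refl_mul_self,
        Module.End.one_apply]
    have h2 := rep_wordProd_apply_of_not_mem cs hi x
    rw [h1, refl_apply] at h2
    have h3 : form M (root i) x = 0 := by simpa [root] using h2
    have h4 : rep cs (cs.wordProd l) x = x := by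
      rw [h1, refl_apply, h3]
      simp
    intro k hk
    rcases List.mem_cons.1 hk with rfl | hk
    · exact h3
    · exact ih hl h4 k hk

lemma eq_zero_of_rep_eq [Finite W] {l : List B} (hl : l.Nodup) (hmem : ∀ i, i ∈ l) {x : B → ℝ}
    (h : rep cs (cs.wordProd l) x = x) : x = 0 := by
  by_contra hx
  refine (form_self_pos cs hx).ne' ?_
  rw [form_eq_sum]
  refine Finset.sum_eq_zero fun i _ => ?_
  rw [form_comm, form_root_eq_zero_of_rep_eq cs hl h i (hmem i), mul_zero]

lemma rep_wordProd_weight [Finite W] {l : List B} {k : B} (hk : k ∉ l) :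
    rep cs (cs.wordProd l) (weight cs k) = weight cs k := by
  induction l with
  | nil => simp
  | cons i l ih =>
    rw [List.mem_cons, not_or] at hk
    rw [cs.wordProd_cons, rep_mul_apply, ih hk.2, rep_simple, refl_weight_of_ne cs (Ne.symm hk.1)]

lemma rep_inv_eq_iff (w : W) (x y : B → ℝ) : rep cs w⁻¹ x = y ↔ x = rep cs w y := by
  constructor
  · rintro rfl
    rw [rep_rep_inv]
  · rintro rfl
    rw [rep_inv_rep]

lemma rep_coxeter_weight [Finite W] {a b : List B} {i : B} (h : (a ++ i :: b).Nodup) :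
    rep cs (cs.wordProd (a ++ i :: b)) (weight cs i) =
      weight cs i - rep cs (cs.wordProd a) (root i) := by
  have ha : i ∉ a := fun hi => (List.nodup_append.1 h).2.2 i hi i (by simp) rfl
  have hb : i ∉ b := (List.nodup_cons.1 (List.nodup_append.1 h).2.1).1
  rw [cs.wordProd_append, cs.wordProd_cons, rep_mul_apply, rep_mul_apply,
    rep_wordProd_weight cs hb, rep_simple, refl_weight_self, map_sub, rep_wordProd_weight cs ha]

lemma rep_coxeter_inv_weight [Finite W] {a b : List B} {i : B} (h : (a ++ i :: b).Nodup) :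
    rep cs (cs.wordProd (a ++ i :: b))⁻¹ (weight cs i) =
      weight cs i - rep cs (cs.wordProd b)⁻¹ (root i) := by
  have ha : i ∉ a := fun hi => (List.nodup_append.1 h).2.2 i hi i (by simp) rfl
  have hb : i ∉ b := (List.nodup_cons.1 (List.nodup_append.1 h).2.1).1
  rw [rep_inv_eq_iff, cs.wordProd_append, cs.wordProd_cons, rep_mul_apply, rep_mul_apply, map_sub,
    rep_rep_inv, rep_wordProd_weight cs hb, rep_simple, map_sub, refl_weight_self, refl_root_self,
    sub_neg_eq_add, sub_add_cancel, rep_wordProd_weight cs ha]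

/-- Representatives of the orbits of `c` on the roots. -/
noncomputable def orbitRoot [Finite W] (c : W) (i : B) : B → ℝ :=
  weight cs i - rep cs c⁻¹ (weight cs i)

lemma orbitRoot_wordProd [Finite W] {a b : List B} {i : B} (h : (a ++ i :: b).Nodup) :
    orbitRoot cs (cs.wordProd (a ++ i :: b)) i = rep cs (cs.wordProd b)⁻¹ (root i) := by
  rw [orbitRoot, rep_coxeter_inv_weight cs h, sub_sub_cancel]

lemma rep_orbitRoot [Finite W] {c x : W} (h : Commute x c) (i : B) :
    rep cs x (orbitRoot cs c i) =
      rep cs x (weight cs i) - rep cs c⁻¹ (rep cs x (weight cs i)) := by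
  rw [orbitRoot, map_sub, ← rep_mul_apply, h.inv_right.eq, rep_mul_apply]

lemma rep_weight_eq_of_rep_orbitRoot_eq [Finite W] {l : List B} (hl : l.Nodup)
    (hmem : ∀ i, i ∈ l) {x : W} (hx : Commute x (cs.wordProd l)) {i j : B}
    (h : rep cs x (orbitRoot cs (cs.wordProd l) i) = orbitRoot cs (cs.wordProd l) j) :
    rep cs x (weight cs i) = weight cs j := by
  rw [rep_orbitRoot cs hx, orbitRoot] at h
  rw [← sub_eq_zero]
  apply eq_zero_of_rep_eq cs hl hmem
  rw [eq_comm, ← rep_inv_eq_iff, map_sub]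
  rw [sub_eq_sub_iff_sub_eq_sub] at h
  exact h.symm

lemma sum_rep_pow [Finite W] {l : List B} (hl : l.Nodup) (hmem : ∀ i, i ∈ l) (x : B → ℝ) :
    ∑ m ∈ Finset.range (orderOf (cs.wordProd l)), rep cs (cs.wordProd l ^ m) x = 0 := by
  apply eq_zero_of_rep_eq cs hl hmem
  rw [map_sum]
  simp only [← rep_mul_apply, ← pow_succ']
  rw [← sub_eq_zero, ← Finset.sum_sub_distrib, Finset.sum_range_sub (fun m =>
    rep cs (cs.wordProd l ^ m) x), pow_orderOf_eq_one, pow_zero, sub_self]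

lemma exists_pow_nonneg [Finite W] {l : List B} (hl : l.Nodup) (hmem : ∀ i, i ∈ l) (w : W)
    (j : B) : ∃ m : ℕ, 0 ≤ rep cs (cs.wordProd l ^ m * w) (root j) := by
  by_contra! hcon
  have hneg : ∀ m : ℕ, rep cs (cs.wordProd l ^ m * w) (root j) ≤ 0 := fun m =>
    (rep_root_nonneg_or_nonpos cs _ j).resolve_left (hcon m)
  have hsum := sum_rep_pow cs hl hmem (rep cs w (root j))
  simp only [← rep_mul_apply] at hsum
  have h0 := (Finset.sum_eq_zero_iff_of_nonpos fun m _ => hneg m).1 hsum 0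
    (Finset.mem_range.2 (orderOf_pos _))
  exact rep_root_ne_zero cs _ j h0

/-- Every root is in the `c`-orbit of one of the representatives. -/
theorem exists_pow_rep_eq_orbitRoot [Finite W] {l : List B} (hl : l.Nodup) (hmem : ∀ i, i ∈ l)
    (w : W) (j : B) : ∃ (m : ℕ) (i : B),
      rep cs (cs.wordProd l ^ m * w) (root j) = orbitRoot cs (cs.wordProd l) i := by
  obtain ⟨p, hp⟩ := exists_pow_nonneg cs hl hmem w j
  obtain ⟨m, hm0, hm1⟩ : ∃ m : ℕ, 0 ≤ rep cs (cs.wordProd l ^ m * w) (root j) ∧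
      rep cs (cs.wordProd l ^ (m + 1) * w) (root j) ≤ 0 := by
    by_contra! hcon
    have hpos : ∀ m : ℕ, 0 ≤ rep cs (cs.wordProd l ^ (p + m) * w) (root j) := by
      intro m
      induction m with
      | zero => exact hp
      | succ m ih =>
        exact (rep_root_nonneg_or_nonpos cs _ j).resolve_right (hcon (p + m) ih)
    have hsum := sum_rep_pow cs hl hmem (rep cs (cs.wordProd l ^ p * w) (root j))
    simp only [← rep_mul_apply, ← mul_assoc, ← pow_add, add_comm _ p] at hsum
    have h0 := (Finset.sum_eq_zero_iff_of_nonneg fun m _ => hpos m).1 hsum 0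
      (Finset.mem_range.2 (orderOf_pos _))
    exact rep_root_ne_zero cs _ j h0
  rw [pow_succ', mul_assoc] at hm1
  obtain ⟨a, i, b, rfl, h⟩ := exists_split_of_nonpos cs hm0 l hm1
  refine ⟨m, i, ?_⟩
  rw [orbitRoot_wordProd cs hl, ← h, rep_mul_apply cs (cs.wordProd b), rep_inv_rep]

lemma root_eq_sum_weight [Finite W] (j : B) :
    root j = ∑ k, (2 * form M (root j) (root k)) • weight cs k := by
  have h : ∀ y, form M (root j - ∑ k, (2 * form M (root j) (root k)) • weight cs k) y = 0 := by
    intro y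
    simp only [map_sub, map_sum, map_smul, LinearMap.sub_apply, LinearMap.sum_apply,
      LinearMap.smul_apply, form_weight, smul_eq_mul]
    rw [form_eq_sum, sub_eq_zero]
    exact Finset.sum_congr rfl fun k _ => by ring
  rw [← sub_eq_zero]
  by_contra hne
  exact (form_self_pos cs hne).ne' (h _)

/-- If `w` fixes a simple root and the corresponding fundamental weight, then it fixes the
fundamental weights of all neighbours. -/
lemma rep_weight_eq_of_adj [Finite W] {w : W} {j k : B} (hr : rep cs w (root j) = root j)
    (hw : rep cs w (weight cs j) = weight cs j) (hjk : form M (root j) (root k) ≠ 0) :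
    rep cs w (weight cs k) = weight cs k := by
  have h1 : ∑ i, (-(2 * form M (root j) (root i))) • (weight cs i - rep cs w (weight cs i)) = 0 := by
    have h2 : root j - rep cs w (root j) = 0 := by rw [hr, sub_self]
    rw [root_eq_sum_weight cs j, map_sum, ← Finset.sum_sub_distrib] at h2
    rw [← neg_eq_zero, ← Finset.sum_neg_distrib]
    rw [← h2]
    refine Finset.sum_congr rfl fun i _ => ?_
    rw [map_smul]
    module
  have h3 : ∀ i ∈ Finset.univ,
      0 ≤ (-(2 * form M (root j) (root i))) • (weight cs i - rep cs w (weight cs i)) := by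
    intro i _
    by_cases hij : j = i
    · subst hij
      rw [hw, sub_self, smul_zero]
    · refine smul_nonneg ?_ (sub_nonneg.2 (rep_weight_le cs w i))
      have := form_root_nonpos (M := M) hij
      linarith
  have h4 := (Finset.sum_eq_zero_iff_of_nonneg h3).1 h1 k (Finset.mem_univ k)
  rcases smul_eq_zero.1 h4 with h | h
  · exact absurd (by linarith) hjk
  · exact (sub_eq_zero.1 h).symm

lemma eq_one_of_rep_root_eq {w : W} (h : ∀ j, rep cs w (root j) = root j) : w = 1 := by
  apply rep_injective cs
  refine LinearMap.ext fun x => ?_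
  rw [map_one, Module.End.one_apply]
  conv_lhs => rw [eq_sum_root x]
  conv_rhs => rw [eq_sum_root x]
  simp [h]

lemma rep_wordProd_root_of_orthogonal {l : List B} {j : B}
    (h : ∀ i ∈ l, form M (root i) (root j) = 0) : rep cs (cs.wordProd l) (root j) = root j := by
  induction l with
  | nil => simp
  | cons i l ih =>
    rw [cs.wordProd_cons, rep_mul_apply, ih fun k hk => h k (by simp [hk]), rep_simple, refl_apply,
      h i (by simp)]
    simp

/-- A bipartite Coxeter word, such that an element commuting with its product is trivial as soon
as it fixes a fundamental weight. -/
theorem exists_bipartite_word [Finite W] (hirr : IsIrreducibleCS cs) :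
    ∃ l : List B, l.Nodup ∧ (∀ i, i ∈ l) ∧ ∀ x : W, Commute x (cs.wordProd l) → ∀ i,
      rep cs x (weight cs i) = weight cs i → x = 1 := by
  classical
  obtain ⟨ε, hε⟩ := exists_coloring cs (Finset.univ : Finset B)
  set p := (Finset.univ.filter ε).toList with hp
  set q := (Finset.univ.filter fun i => ¬ ε i).toList with hq
  have hmp : ∀ i, i ∈ p ↔ ε i := by simp [hp]
  have hmq : ∀ i, i ∈ q ↔ ¬ ε i := by simp [hq]
  have hnd : (p ++ q).Nodup := List.nodup_append.2 ⟨Finset.nodup_toList _, Finset.nodup_toList _,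
    fun a ha b hb hab => (hmq b).1 hb (hab ▸ (hmp a).1 ha)⟩
  have hmem : ∀ i, i ∈ p ++ q := fun i => by
    rw [List.mem_append, hmp, hmq]
    exact em _
  have horth : ∀ i j, i ≠ j → (ε i ↔ ε j) → form M (root i) (root j) = 0 := by
    intro i j hij h
    by_contra hf
    have := hε i (Finset.mem_univ _) j (Finset.mem_univ _) hij hf
    tauto
  refine ⟨p ++ q, hnd, hmem, fun x hx i hi => ?_⟩
  have hroot : ∀ j, rep cs x (weight cs j) = weight cs j → rep cs x (root j) = root j := by
    intro j hj
    by_cases hjε : ε j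
    · obtain ⟨a, b, hab⟩ := List.append_of_mem ((hmp j).2 hjε)
      have hnd' := hnd
      rw [hab, List.append_assoc, List.cons_append] at hnd'
      have h1 := rep_coxeter_weight cs hnd'
      rw [rep_wordProd_root_of_orthogonal cs fun i hi => horth i j
        (fun h => (List.nodup_append.1 hnd').2.2 i hi j (by simp) h)
        (iff_of_true ((hmp i).1 (by simp [hab, hi])) hjε)] at h1
      rw [hab, List.append_assoc, List.cons_append] at hx
      have h2 := congrArg (rep cs x) h1
      rw [← rep_mul_apply, hx.eq, rep_mul_apply, map_sub, hj, h1] at h2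
      exact (sub_right_injective h2).symm
    · obtain ⟨a, b, hab⟩ := List.append_of_mem ((hmq j).2 hjε)
      have hnd' := hnd
      rw [hab, ← List.append_assoc] at hnd'
      have h1 := rep_coxeter_inv_weight cs hnd'
      have hb : rep cs (cs.wordProd b)⁻¹ (root j) = root j := by
        rw [rep_inv_eq_iff]
        refine (rep_wordProd_root_of_orthogonal cs fun i hi => horth i j ?_
          (iff_of_false ((hmq i).1 (by simp [hab, hi])) hjε)).symm
        rintro rfl
        exact (List.nodup_cons.1 (List.nodup_append.1 hnd').2.1).1 hi
      rw [hb] at h1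
      rw [hab, ← List.append_assoc] at hx
      have h2 := congrArg (rep cs x) h1
      rw [← rep_mul_apply, hx.inv_right.eq, rep_mul_apply, map_sub, hj, h1] at h2
      exact (sub_right_injective h2).symm
  have hJ := hirr.2 {j | rep cs x (weight cs j) = weight cs j} fun a ha b hb => by
    by_contra hcon
    refine hb (rep_weight_eq_of_adj cs (hroot a ha) ha fun h => hcon ?_)
    exact commute_simple cs h
  rcases hJ with h | h
  · exact absurd (h ▸ hi : i ∈ (∅ : Set B)) (Set.notMem_empty i)
  · exact eq_one_of_rep_root_eq cs fun j => hroot j (Set.eq_univ_iff_forall.1 h j)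

/-- A power of a Coxeter element fixing a root is trivial. -/
theorem pow_eq_one_of_rep_root_eq [Finite W] (hirr : IsIrreducibleCS cs) {l : List B}
    (hl : l.Nodup) (hmem : ∀ i, i ∈ l) {n : ℕ} {w : W} {j : B}
    (h : rep cs (cs.wordProd l ^ n) (rep cs w (root j)) = rep cs w (root j)) :
    cs.wordProd l ^ n = 1 := by
  obtain ⟨l₀, hl₀, hmem₀, H⟩ := exists_bipartite_word cs hirr
  have hperm : l.Perm l₀ := (List.perm_ext_iff_of_nodup hl hl₀).2 fun i => by simp [hmem, hmem₀]
  obtain ⟨g, hg⟩ := isConj_iff.1 (isConj_of_perm cs hperm hl)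
  set c := cs.wordProd l with hc
  set c₀ := cs.wordProd l₀ with hc₀
  have hpow : c₀ ^ n = g * c ^ n * g⁻¹ := by rw [← hg, conj_pow]
  obtain ⟨m, i, hi⟩ := exists_pow_rep_eq_orbitRoot cs hl₀ hmem₀ (g * w) j
  have hfix : rep cs (c₀ ^ n) (orbitRoot cs c₀ i) = orbitRoot cs c₀ i := by
    rw [← hi, ← hc₀, ← rep_mul_apply, ← mul_assoc, ← pow_add, add_comm, pow_add, mul_assoc,
      ← mul_assoc (c₀ ^ n), hpow, rep_mul_apply, rep_mul_apply cs (c₀ ^ m)]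
    congr 1
    rw [inv_mul_cancel_right, rep_mul_apply, rep_mul_apply, h, rep_mul_apply]
  have h1 := H (c₀ ^ n) ((Commute.refl c₀).pow_left n) i
    (rep_weight_eq_of_rep_orbitRoot_eq cs hl₀ hmem₀ ((Commute.refl c₀).pow_left n) hfix)
  rw [hpow] at h1
  exact conj_eq_one_iff.1 h1

lemma exists_rep_eq_orbitRoot [Finite W] {l : List B} (hl : l.Nodup) (hmem : ∀ i, i ∈ l) (i : B) :
    ∃ w : W, rep cs w (root i) = orbitRoot cs (cs.wordProd l) i := by
  obtain ⟨a, b, rfl⟩ := List.append_of_mem (hmem i)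
  exact ⟨_, (orbitRoot_wordProd cs hl).symm⟩

/-- The roots are the vectors `c ^ m θᵢ` with `m < h`, each occurring once. -/
theorem existsUnique_pow_orbitRoot [Finite W] (hirr : IsIrreducibleCS cs) {l : List B}
    (hl : l.Nodup) (hmem : ∀ i, i ∈ l) (w : W) (j : B) :
    ∃! p : ℕ × B, p.1 < orderOf (cs.wordProd l) ∧
      rep cs (cs.wordProd l ^ p.1) (orbitRoot cs (cs.wordProd l) p.2) = rep cs w (root j) := by
  set c := cs.wordProd l with hc
  apply existsUnique_of_exists_of_unique
  · obtain ⟨m, i, h⟩ := exists_pow_rep_eq_orbitRoot cs hl hmem w j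
    obtain ⟨k, hk, hkm⟩ : ∃ k < orderOf c, c ^ k = (c ^ m)⁻¹ := by
      obtain ⟨e, he⟩ := mem_powers_iff_mem_zpowers.2
        (inv_mem (pow_mem (Subgroup.mem_zpowers c) m))
      exact ⟨e % orderOf c, Nat.mod_lt _ (orderOf_pos c), (pow_mod_orderOf c e).trans he⟩
    refine ⟨(k, i), hk, ?_⟩
    rw [hkm, ← h, rep_mul_apply, rep_inv_rep]
  · have key : ∀ m₁ m₂ i₁ i₂, m₁ < orderOf c → m₂ < orderOf c → m₁ ≤ m₂ →
        rep cs (c ^ m₁) (orbitRoot cs c i₁) = rep cs (c ^ m₂) (orbitRoot cs c i₂) →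
        m₁ = m₂ ∧ i₁ = i₂ := by
      intro m₁ m₂ i₁ i₂ h₁ h₂ hle h
      obtain ⟨d, rfl⟩ := Nat.exists_eq_add_of_le hle
      have h3 : rep cs (c ^ d) (orbitRoot cs c i₂) = orbitRoot cs c i₁ := by
        rw [← rep_inv_rep cs (c ^ m₁) (orbitRoot cs c i₁), h, pow_add, rep_mul_apply, rep_inv_rep]
      have hi := eq_of_rep_weight_eq cs (rep_weight_eq_of_rep_orbitRoot_eq cs hl hmem
        ((Commute.refl c).pow_left d) h3)
      subst hi
      obtain ⟨w', hw'⟩ := exists_rep_eq_orbitRoot cs hl hmem i₂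
      rw [← hw'] at h3
      have h4 : c ^ d = 1 := pow_eq_one_of_rep_root_eq cs hirr hl hmem h3
      have h5 := Nat.eq_zero_of_dvd_of_lt (orderOf_dvd_of_pow_eq_one h4) (by omega)
      exact ⟨by omega, rfl⟩
    rintro ⟨m₁, i₁⟩ ⟨m₂, i₂⟩ ⟨h₁, e₁⟩ ⟨h₂, e₂⟩
    rcases le_total m₁ m₂ with hle | hle
    · obtain ⟨rfl, rfl⟩ := key m₁ m₂ i₁ i₂ h₁ h₂ hle (e₁.trans e₂.symm)
      rfl
    · obtain ⟨rfl, rfl⟩ := key m₂ m₁ i₂ i₁ h₂ h₁ hle (e₂.trans e₁.symm)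
      rfl

end CoxeterElements

section Chains

variable {G : Type*} [Group G]

/-- Chains counted by `twCount`, in terms of the jumps, for a length function `L`. -/
def IsJumpChain (L : G → ℕ) (d : G) {k : ℕ} (y : Fin (k + 1) → G) : Prop :=
  y 0 = 1 ∧ (∀ i : Fin k, L ((y i.castSucc)⁻¹ * y i.succ) = 1) ∧
    ∀ i : Fin (k + 1), L ((y i)⁻¹ * d) + i = L d

lemma IsJumpChain.length_eq {L : G → ℕ} (h1 : L 1 = 0) (hmul : ∀ u v, L (u * v) ≤ L u + L v)
    {d : G} {k : ℕ} {y : Fin (k + 1) → G} (h : IsJumpChain L d y) (i : Fin (k + 1)) :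
    L (y i) = i := by
  have hle : L (y i) ≤ i := by
    induction i using Fin.induction with
    | zero => simp [h.1, h1]
    | succ i ih =>
      have h2 := hmul (y i.castSucc) ((y i.castSucc)⁻¹ * y i.succ)
      rw [mul_inv_cancel_left, h.2.1] at h2
      rw [Fin.val_castSucc] at ih
      rw [Fin.val_succ]
      omega
  have h3 := hmul (y i) ((y i)⁻¹ * d)
  rw [mul_inv_cancel_left] at h3
  have h4 := h.2.2 i
  omega

lemma twCount_eq_card {S : Set G} {L : G → ℕ} (hS : ∀ w, absLength S w = L w) (h1 : L 1 = 0)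
    (hmul : ∀ u v, L (u * v) ≤ L u + L v) (d : G) (k : ℕ) :
    twCount S d k = Nat.card {y : Fin (k + 1) → G // IsJumpChain L d y} := by
  refine Nat.card_congr (Equiv.subtypeEquivRight fun y => ?_)
  simp only [absLe, hS]
  constructor
  · rintro ⟨h0, hle, hstep, hlen⟩
    refine ⟨h0, fun i => ?_, fun i => ?_⟩
    · have := hstep i
      rw [hlen, hlen, Fin.val_castSucc, Fin.val_succ] at this
      omega
    · have := hle i
      rw [hlen] at this
      omega
  · intro h
    have hlen := h.length_eq h1 hmul
    refine ⟨h.1, fun i => ?_, fun i => ?_, hlen⟩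
    · rw [hlen, ← h.2.2 i, add_comm]
    · rw [hlen, hlen, h.2.1, Fin.val_castSucc, Fin.val_succ]

lemma IsJumpChain.conj {L : G → ℕ} (hconj : ∀ g w, L (g * w * g⁻¹) = L w) {d : G} {k : ℕ}
    {y : Fin (k + 1) → G} (h : IsJumpChain L d y) (g : G) :
    IsJumpChain L (g * d * g⁻¹) fun i => g * y i * g⁻¹ := by
  refine ⟨by simp [h.1], fun i => ?_, fun i => ?_⟩
  · refine Eq.trans ?_ (h.2.1 i)
    rw [← hconj g ((y i.castSucc)⁻¹ * y i.succ)]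
    congr 1
    group
  · rw [hconj, ← h.2.2 i, ← hconj g ((y i)⁻¹ * d)]
    congr 2
    group

lemma card_jumpChain_conj {L : G → ℕ} (hconj : ∀ g w, L (g * w * g⁻¹) = L w) (d g : G) (k : ℕ) :
    Nat.card {y : Fin (k + 1) → G // IsJumpChain L (g * d * g⁻¹) y} =
      Nat.card {y : Fin (k + 1) → G // IsJumpChain L d y} := by
  refine Nat.card_congr ⟨fun y => ⟨fun i => g⁻¹ * y.1 i * g⁻¹⁻¹, ?_⟩,
    fun y => ⟨fun i => g * y.1 i * g⁻¹, y.2.conj hconj g⟩, fun y => ?_, fun y => ?_⟩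
  · have := y.2.conj hconj g⁻¹
    rwa [show g⁻¹ * (g * d * g⁻¹) * g⁻¹⁻¹ = d by group] at this
  · ext i
    simp only
    group
  · ext i
    simp only
    group

lemma isJumpChain_cons_iff {L : G → ℕ} {d t : G} (ht : L t = 1) (htd : L (t⁻¹ * d) + 1 = L d)
    {k : ℕ} {z : Fin (k + 1) → G} (hz : z 0 = 1) :
    IsJumpChain L d (Fin.cons 1 (fun i => t * z i) : Fin (k + 2) → G) ↔
      IsJumpChain L (t⁻¹ * d) z := by
  constructor
  · rintro ⟨-, h1, h2⟩
    refine ⟨hz, fun i => ?_, fun i => ?_⟩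
    · have := h1 i.succ
      rw [← Fin.succ_castSucc, Fin.cons_succ, Fin.cons_succ] at this
      rw [← this]
      congr 1
      group
    · have := h2 i.succ
      rw [Fin.cons_succ, mul_inv_rev, mul_assoc, Fin.val_succ] at this
      omega
  · rintro ⟨-, h1, h2⟩
    refine ⟨rfl, fun i => ?_, fun i => ?_⟩
    · refine Fin.cases ?_ (fun i => ?_) i
      · rw [Fin.cons_succ, Fin.castSucc_zero, Fin.cons_zero, hz, inv_one, one_mul, mul_one, ht]
      · rw [← Fin.succ_castSucc, Fin.cons_succ, Fin.cons_succ, ← h1 i]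
        congr 1
        group
    · refine Fin.cases ?_ (fun i => ?_) i
      · simp
      · have := h2 i
        rw [Fin.cons_succ, mul_inv_rev, mul_assoc, Fin.val_succ]
        omega

lemma card_jumpChain_succ [Fintype G] (L : G → ℕ) (d : G) (k : ℕ) :
    Nat.card {y : Fin (k + 2) → G // IsJumpChain L d y} =
      ∑ t : {t : G // L t = 1 ∧ L (t⁻¹ * d) + 1 = L d},
        Nat.card {y : Fin (k + 1) → G // IsJumpChain L (t.1⁻¹ * d) y} := by
  classical
  rw [← Nat.card_sigma]
  symm
  refine Nat.card_congr (Equiv.ofBijective (fun p => ⟨Fin.cons 1 fun i => p.1.1 * p.2.1 i,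
    (isJumpChain_cons_iff p.1.2.1 p.1.2.2 p.2.2.1).2 p.2.2⟩) ⟨?_, ?_⟩)
  · rintro ⟨⟨t, ht⟩, ⟨z, hz⟩⟩ ⟨⟨t', ht'⟩, ⟨z', hz'⟩⟩ h
    have h' : (Fin.cons 1 fun i => t * z i : Fin (k + 2) → G) = Fin.cons 1 fun i => t' * z' i :=
      congrArg Subtype.val h
    replace h' := (Fin.cons_inj.1 h').2
    have htt : t = t' := by
      have := congrFun h' 0
      simpa [hz.1, hz'.1] using this
    subst htt
    have hzz : z = z' := funext fun i => mul_left_cancel (congrFun h' i)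
    subst hzz
    rfl
  · rintro ⟨y, hy⟩
    have hyt : (Fin.cons 1 fun i => y 1 * ((y 1)⁻¹ * y i.succ) : Fin (k + 2) → G) = y := by
      funext i
      refine Fin.cases ?_ (fun i => ?_) i
      · simp [hy.1]
      · simp
    have ht : L (y 1) = 1 := by
      have := hy.2.1 0
      rwa [Fin.castSucc_zero, hy.1, inv_one, one_mul] at this
    have htd : L ((y 1)⁻¹ * d) + 1 = L d := by
      simpa using hy.2.2 1
    refine ⟨⟨⟨y 1, ht, htd⟩, ⟨fun i => (y 1)⁻¹ * y i.succ, ?_⟩⟩, Subtype.ext hyt⟩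
    refine (isJumpChain_cons_iff ht htd ?_).1 ?_
    · simp
    · rwa [hyt]

end Chains

section Recursion

variable {B : Type*} [Fintype B] [DecidableEq B] {M : CoxeterMatrix B} {W : Type*} [Group W]
  (cs : CoxeterSystem M W)

lemma rep_conj_simple_eq_neg_iff {g : W} {j : B} {β : B → ℝ} (hβ : form M β β = 1) :
    rep cs (g * cs.simple j * g⁻¹) β = -β ↔
      β = rep cs g (root j) ∨ β = rep cs (g * cs.simple j) (root j) := by
  rw [rep_mul_simple_root, rep_conj_simple_apply]
  have hγ := form_rep_root_self cs g j
  generalize rep cs g (root j) = γ at *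
  constructor
  · intro h
    have h1 : β = form M γ β • γ := by
      have h2 : (2 : ℝ) • (β - form M γ β • γ) = 0 := by
        rw [← sub_eq_zero, sub_neg_eq_add] at h
        rw [← h]
        module
      rcases smul_eq_zero.1 h2 with h3 | h3
      · norm_num at h3
      · exact sub_eq_zero.1 h3
    generalize form M γ β = a at *
    rw [h1] at hβ
    simp only [map_smul, LinearMap.smul_apply, hγ, smul_eq_mul, mul_one] at hβ
    rcases mul_self_eq_one_iff.1 hβ with rfl | rfl
    · left
      rw [h1, one_smul]
    · right
      rw [h1, neg_smul, one_smul]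
  · rintro (rfl | rfl)
    · rw [hγ]
      module
    · rw [map_neg, hγ]
      module

lemma conj_simple_eq_of_rep_eq_neg {g u : W} {i j : B}
    (h : rep cs (g * cs.simple j * g⁻¹) (rep cs u (root i)) = -rep cs u (root i)) :
    g * cs.simple j * g⁻¹ = u * cs.simple i * u⁻¹ := by
  rcases (rep_conj_simple_eq_neg_iff cs (form_rep_root_self cs u i)).1 h with h | h
  · exact (conj_simple_eq cs h).symm
  · rw [conj_simple_eq cs h, mul_inv_rev]
    simp [mul_assoc]

lemma rep_conj_simple_self (u : W) (i : B) :
    rep cs (u * cs.simple i * u⁻¹) (rep cs u (root i)) = -rep cs u (root i) :=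
  (rep_conj_simple_eq_neg_iff cs (form_rep_root_self cs u i)).2 (Or.inl rfl)

lemma exists_conj_of_cod_eq_one [Finite W] {t : W} (ht : cod cs t = 1) :
    ∃ (g : W) (j : B), t = g * cs.simple j * g⁻¹ :=
  (isReflectionOf_simpleSet cs).1 ((isReflectionOf_iff_cod cs).2 ht)

/-- Summation over reflections by means of the orbits of a Coxeter element on the roots. -/
theorem two_mul_sum_reflections [Fintype W] (hirr : IsIrreducibleCS cs) {l : List B}
    (hl : l.Nodup) (hmem : ∀ i, i ∈ l) {w : B → W}
    (hw : ∀ i, rep cs (w i) (root i) = orbitRoot cs (cs.wordProd l) i) {F : W → ℕ}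
    (hF : ∀ t, F (cs.wordProd l * t * (cs.wordProd l)⁻¹) = F t) :
    2 * ∑ t with cod cs t = 1, F t =
      orderOf (cs.wordProd l) * ∑ i, F (w i * cs.simple i * (w i)⁻¹) := by
  classical
  set c := cs.wordProd l with hc
  set P := Finset.range (orderOf c) ×ˢ (Finset.univ : Finset B) with hP
  set β : ℕ × B → B → ℝ := fun p => rep cs (c ^ p.1 * w p.2) (root p.2) with hβ
  have huniq : ∀ (u : W) (j : B), ∃! p, p ∈ P ∧ β p = rep cs u (root j) := by
    intro u j
    have := existsUnique_pow_orbitRoot cs hirr hl hmem u j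
    simpa only [hP, Finset.mem_product, Finset.mem_range, Finset.mem_univ, and_true, hβ,
      rep_mul_apply, hw] using this
  have hcard : ∀ t ∈ Finset.univ.filter fun t => cod cs t = 1,
      (P.filter fun p => rep cs t (β p) = -β p).card = 2 := by
    intro t ht
    obtain ⟨g, j, rfl⟩ := exists_conj_of_cod_eq_one cs (Finset.mem_filter.1 ht).2
    obtain ⟨p, ⟨hpP, hp⟩, hpu⟩ := huniq g j
    obtain ⟨q, ⟨hqP, hq⟩, hqu⟩ := huniq (g * cs.simple j) j
    rw [Finset.card_eq_two]
    refine ⟨p, q, ?_, ?_⟩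
    · rintro rfl
      rw [hp, rep_mul_simple_root] at hq
      have h1 := form_rep_root_self cs g j
      rw [self_eq_neg.1 hq] at h1
      simp at h1
    · ext x
      rw [Finset.mem_filter, rep_conj_simple_eq_neg_iff cs (form_rep_root_self cs _ _),
        Finset.mem_insert, Finset.mem_singleton]
      constructor
      · rintro ⟨hx, h | h⟩
        · exact Or.inl (hpu x ⟨hx, h⟩)
        · exact Or.inr (hqu x ⟨hx, h⟩)
      · rintro (rfl | rfl)
        · exact ⟨hpP, Or.inl hp⟩
        · exact ⟨hqP, Or.inr hq⟩
  have hFpow : ∀ (m : ℕ) (t : W), F (c ^ m * t * (c ^ m)⁻¹) = F t := by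
    intro m t
    induction m with
    | zero => simp
    | succ m ih =>
      rw [← ih, ← hF (c ^ m * t * (c ^ m)⁻¹), pow_succ']
      congr 1
      group
  have hsum : ∀ p, ∑ t with cod cs t = 1, (if rep cs t (β p) = -β p then F t else 0) =
      F (w p.2 * cs.simple p.2 * (w p.2)⁻¹) := by
    rintro ⟨m, i⟩
    set t₀ := c ^ m * w i * cs.simple i * (c ^ m * w i)⁻¹ with ht₀
    have ht₀F : F t₀ = F (w i * cs.simple i * (w i)⁻¹) := by
      rw [← hFpow m (w i * cs.simple i * (w i)⁻¹)]
      congr 1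
      rw [ht₀]
      group
    rw [Finset.sum_eq_single t₀, if_pos (rep_conj_simple_self cs _ _), ht₀F]
    · intro t ht hne
      obtain ⟨g, j, rfl⟩ := exists_conj_of_cod_eq_one cs (Finset.mem_filter.1 ht).2
      exact if_neg fun h => hne (conj_simple_eq_of_rep_eq_neg cs h)
    · intro h
      refine absurd (Finset.mem_filter.2 ⟨Finset.mem_univ _, ?_⟩) h
      rw [ht₀, cod_conj, cod_simple]
  calc 2 * ∑ t with cod cs t = 1, F t
      = ∑ t with cod cs t = 1, ∑ p ∈ P, (if rep cs t (β p) = -β p then F t else 0) := by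
        rw [Finset.mul_sum]
        refine Finset.sum_congr rfl fun t ht => ?_
        rw [← Finset.sum_filter, Finset.sum_const, hcard t ht, smul_eq_mul]
    _ = ∑ p ∈ P, F (w p.2 * cs.simple p.2 * (w p.2)⁻¹) := by
        rw [Finset.sum_comm]
        exact Finset.sum_congr rfl fun p _ => hsum p
    _ = orderOf c * ∑ i, F (w i * cs.simple i * (w i)⁻¹) := by
        simp [hP, Finset.sum_product]

/-- The number of saturated chains of length `k` starting at `1` in the interval `[1, d]`. -/
noncomputable def chainNumber (d : W) (k : ℕ) : ℕ :=
  Nat.card {y : Fin (k + 1) → W // IsJumpChain (cod cs) d y}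

lemma twCount_simpleSet [Finite W] (d : W) (k : ℕ) :
    twCount (simpleSet cs) d k = chainNumber cs d k :=
  twCount_eq_card (absLength_simpleSet cs) ((cod_eq_zero_iff cs).2 rfl) (cod_mul_le cs) d k

lemma twCount_parabolicGens [Finite W] (s : B) (d : parabolic cs s) (k : ℕ) :
    twCount (parabolicGens cs s) d k = chainNumber cs (d : W) k := by
  rw [twCount_eq_card (absLength_parabolicGens cs s) ((cod_eq_zero_iff cs).2 rfl)
    (fun u v => cod_mul_le cs u v)]
  refine Nat.card_congr (Equiv.ofBijective (fun y => ⟨fun i => y.1 i, ?_⟩) ⟨?_, ?_⟩)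
  · exact ⟨congrArg Subtype.val y.2.1, y.2.2.1, y.2.2.2⟩
  · intro y z h
    exact Subtype.ext (funext fun i => Subtype.ext (congrFun (congrArg Subtype.val h) i))
  · rintro ⟨y, hy⟩
    have hlen := hy.length_eq ((cod_eq_zero_iff cs).2 rfl) (cod_mul_le cs)
    have hmem : ∀ i, y i ∈ parabolic cs s := by
      intro i
      rw [parabolic_eq_stdParabolic]
      refine mem_stdParabolic_of_cod_add cs (w := d) ?_ ?_
      · rw [← parabolic_eq_stdParabolic]
        exact d.2
      rw [hlen, ← hy.2.2 i, add_comm]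
    exact ⟨⟨fun i => ⟨y i, hmem i⟩, Subtype.ext hy.1, hy.2.1, hy.2.2⟩, rfl⟩

lemma chainNumber_conj (d g : W) (k : ℕ) :
    chainNumber cs (g * d * g⁻¹) k = chainNumber cs d k :=
  card_jumpChain_conj (cod_conj cs) d g k

lemma chainNumber_eq_of_isConj {d e : W} (h : IsConj d e) (k : ℕ) :
    chainNumber cs d k = chainNumber cs e k := by
  obtain ⟨g, rfl⟩ := isConj_iff.1 h
  exact (chainNumber_conj cs d g k).symm

lemma cod_wordProd_eq_card [Finite W] {l : List B} (hl : l.Nodup) (hmem : ∀ i, i ∈ l) :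
    cod cs (cs.wordProd l) = Fintype.card B :=
  cod_eq_card cs fun _ => eq_zero_of_rep_eq cs hl hmem

/-- All reflections lie below an element without nonzero fixed vectors. -/
lemma cod_reflection_mul [Finite W] {c t : W} (hc : cod cs c = Fintype.card B)
    (ht : cod cs t = 1) : cod cs (t⁻¹ * c) + 1 = cod cs c := by
  have hle := cod_mul_le cs t (t⁻¹ * c)
  rw [mul_inv_cancel_left, ht] at hle
  obtain ⟨g, j, rfl⟩ := exists_conj_of_cod_eq_one cs ht
  set v := g⁻¹ * c * g with hv
  have hcv : cod cs v = Fintype.card B := by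
    rw [← hc, ← cod_conj cs g⁻¹ c, inv_inv]
  have hinj : Function.Injective (rep cs v - 1 : Module.End ℝ (B → ℝ)) := by
    rw [← LinearMap.ker_eq_bot]
    have := cod_add_finrank cs v
    exact Submodule.finrank_eq_zero.1 (by rw [fixSpace] at this; omega)
  obtain ⟨x, hx⟩ := LinearMap.injective_iff_surjective.1 hinj (root j)
  have hlt := finrank_fixSpace_lt cs (w := v) (v := x) (by simpa using hx)
  have h1 := cod_add_finrank cs v
  have h2 := cod_add_finrank cs (cs.simple j * v)
  have h3 : cod cs ((g * cs.simple j * g⁻¹)⁻¹ * c) = cod cs (cs.simple j * v) := by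
    rw [← cod_conj cs g (cs.simple j * v)]
    congr 1
    simp [hv, mul_assoc]
  omega

lemma chainNumber_succ [Fintype W] {c : W} (hc : cod cs c = Fintype.card B) (k : ℕ) :
    chainNumber cs c (k + 1) = ∑ t with cod cs t = 1, chainNumber cs (t⁻¹ * c) k := by
  classical
  rw [chainNumber, card_jumpChain_succ]
  rw [Finset.sum_subtype (p := fun t => cod cs t = 1 ∧ cod cs (t⁻¹ * c) + 1 = cod cs c)]
  · rfl
  · intro t
    simp only [Finset.mem_filter, Finset.mem_univ, true_and]
    exact ⟨fun h => ⟨h, cod_reflection_mul cs hc h⟩, fun h => h.1⟩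

/-- Recursion for the number of chains below a Coxeter element. -/
theorem two_mul_chainNumber [Fintype W] (hirr : IsIrreducibleCS cs) {l : List B}
    (hl : l.Nodup) (hmem : ∀ i, i ∈ l) {l' : B → List B} (hl' : ∀ s, (l' s).Nodup)
    (hmem' : ∀ s i, i ∈ l' s ↔ i ≠ s) (k : ℕ) :
    2 * chainNumber cs (cs.wordProd l) (k + 1) =
      orderOf (cs.wordProd l) * ∑ s, chainNumber cs (cs.wordProd (l' s)) k := by
  choose a b hab using fun s => List.append_of_mem (hmem s)
  have hnd : ∀ s, (a s ++ s :: b s).Nodup := fun s => hab s ▸ hl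
  rw [chainNumber_succ cs (cod_wordProd_eq_card cs hl hmem),
    two_mul_sum_reflections cs hirr hl hmem (w := fun s => (cs.wordProd (b s))⁻¹)]
  · congr 1
    refine Finset.sum_congr rfl fun s _ => ?_
    have hperm : (a s ++ b s).Perm (l' s) := by
      have hnd' : (s :: (a s ++ b s)).Nodup := List.perm_middle.nodup_iff.1 (hnd s)
      refine (List.perm_ext_iff_of_nodup (List.nodup_cons.1 hnd').2 (hl' s)).2 fun i => ?_
      rw [hmem']
      constructor
      · rintro hi rfl
        exact (List.nodup_cons.1 hnd').1 hi
      · intro hi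
        have := hmem i
        rw [hab s, List.perm_middle.mem_iff, List.mem_cons] at this
        exact this.resolve_left hi
    rw [← chainNumber_eq_of_isConj cs
      (isConj_of_perm cs hperm (hperm.nodup_iff.2 (hl' s)))]
    apply chainNumber_eq_of_isConj
    rw [isConj_iff]
    refine ⟨cs.wordProd l, ?_⟩
    conv_lhs => rw [hab s]
    rw [cs.wordProd_append, cs.wordProd_append, cs.wordProd_cons]
    simp [mul_assoc]
  · intro s
    conv_rhs => rw [hab s]
    rw [orbitRoot_wordProd cs (hnd s)]
  · intro t
    rw [← chainNumber_conj cs (t⁻¹ * cs.wordProd l) (cs.wordProd l)]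
    congr 1
    group

lemma exists_word_of_list {L : List W} (hL : L.Nodup) {J : Set B}
    (h : ∀ x, x ∈ L ↔ ∃ i ∈ J, cs.simple i = x) :
    ∃ l : List B, l.Nodup ∧ (∀ i, i ∈ l ↔ i ∈ J) ∧ cs.wordProd l = L.prod := by
  obtain ⟨l, rfl⟩ : L ∈ Set.range (List.map cs.simple) := by
    rw [Set.range_list_map]
    intro x hx
    obtain ⟨i, -, hi⟩ := (h x).1 hx
    exact ⟨i, hi⟩
  refine ⟨l, hL.of_map _, fun i => ?_, rfl⟩
  rw [← List.mem_map_of_injective (simple_injective cs), h]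
  constructor
  · rintro ⟨j, hj, hji⟩
    exact simple_injective cs hji ▸ hj
  · exact fun hi => ⟨i, hi, rfl⟩

lemma exists_word_of_isCoxeterElementOf {c : W} (hc : IsCoxeterElementOf (simpleSet cs) c) :
    ∃ l : List B, l.Nodup ∧ (∀ i, i ∈ l) ∧ cs.wordProd l = c := by
  obtain ⟨L, hL, hmem, rfl⟩ := hc
  obtain ⟨l, hl, hl', hp⟩ := exists_word_of_list cs hL (J := Set.univ) fun x => by
    simp [hmem, simpleSet]
  exact ⟨l, hl, fun i => (hl' i).2 trivial, hp⟩

lemma exists_word_of_isCoxeterElementOf_parabolicGens {s : B} {c : parabolic cs s}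
    (hc : IsCoxeterElementOf (parabolicGens cs s) c) :
    ∃ l : List B, l.Nodup ∧ (∀ i, i ∈ l ↔ i ≠ s) ∧ cs.wordProd l = c := by
  obtain ⟨L, hL, hmem, rfl⟩ := hc
  obtain ⟨l, hl, hl', hp⟩ := exists_word_of_list cs (L := L.map (parabolic cs s).subtype)
    (hL.map Subtype.val_injective) (J := {s}ᶜ) fun x => by
      rw [List.mem_map]
      constructor
      · rintro ⟨y, hy, rfl⟩
        obtain ⟨⟨i, hi⟩, hi'⟩ := (hmem y).1 hy
        exact ⟨i, fun his => hi' (by rw [← hi, his]; rfl), hi⟩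
      · rintro ⟨i, hi, rfl⟩
        have hmem' : cs.simple i ∈ Set.range cs.simple \ {cs.simple s} :=
          ⟨⟨i, rfl⟩, fun h => hi (simple_injective cs h)⟩
        exact ⟨⟨cs.simple i, Subgroup.subset_closure hmem'⟩, (hmem _).2 hmem', rfl⟩
  exact ⟨l, hl, hl', by rw [hp, List.prod_hom]; rfl⟩

end Recursion

end GeomRep

/-- **Corollary (recursion for reduced `T`-words).**
If `(W,S)` is a finite irreducible Coxeter system with Coxeter number `h`, then for
every `k ≥ 1`, `2·TW_k(W) = h · ∑_{s∈S} TW_{k−1}(W_⟨s⟩)`. -/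
theorem tw_count_recursion
    {B : Type} [Fintype B] {W : Type} [Group W] [Fintype W]
    {M : CoxeterMatrix B} (cs : CoxeterSystem M W)
    (hirr : IsIrreducibleCS cs)
    (c : W) (hc : IsCoxeterElementOf (simpleSet cs) c)
    (h : ℕ) (hh : h = orderOf c)
    (c' : ∀ s : B, parabolic cs s)
    (hc' : ∀ s : B, IsCoxeterElementOf (parabolicGens cs s) (c' s))
    (k : ℕ) (hk : 1 ≤ k) :
    2 * twCount (simpleSet cs) c k =
      h * ∑ s : B, twCount (parabolicGens cs s) (c' s) (k - 1) := by
  classical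
  obtain ⟨k, rfl⟩ := Nat.exists_eq_add_of_le' hk
  obtain ⟨l, hl, hmem, rfl⟩ := GeomRep.exists_word_of_isCoxeterElementOf cs hc
  choose l' hl' hmem' hprod using fun s =>
    GeomRep.exists_word_of_isCoxeterElementOf_parabolicGens cs (hc' s)
  rw [hh, GeomRep.twCount_simpleSet, Nat.add_sub_cancel,
    GeomRep.two_mul_chainNumber cs hirr hl hmem hl' hmem']
  simp only [GeomRep.twCount_parabolicGens, hprod]
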